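/- In the sandpile process on a sufficiently large graph approximation SG_i of the Sierpinski gasket obtained by placing grains at v_0 and stabilizing: if in the stabilized configuration some vertex v with d(v, v_0) > 2^j carries at least one grain, then every vertex in V_{2^j} (all vertices within graph distance 2^j of v_0) has toppled at least once. -/

import Mathlib

open Classical

namespace ASM

variable {V : Type*}

/-- The degree of a vertex. -/
noncomputable def deg (G : SimpleGraph V) (v : V) : ℕ := (G.neighborSet v).ncard

/-- The result of toppling the vertex `v`: `v` loses `deg v` grains and each
neighbor of `v` receives one grain. -/
noncomputable def toppleAt (G : SimpleGraph V) (η : V → ℕ) (v : V) : V → ℕ :=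
  fun u => if u = v then η v - deg G v else η u + (if G.Adj v u then 1 else 0)

/-- `Topples G S η l η'` means that starting from the configuration `η`, the vertices in
the list `l` may be legally toppled in order (each toppled vertex is not a sink and holds
at least `deg` many grains when toppled), resulting in the configuration `η'`.
`S` is the set of sink vertices. -/
inductive Topples (G : SimpleGraph V) (S : Set V) : (V → ℕ) → List V → (V → ℕ) → Prop
  | nil (η : V → ℕ) : Topples G S η [] η
  | cons {η η' : V → ℕ} {l : List V} (v : V) (hv : v ∉ S) (hge : deg G v ≤ η v)
      (ht : Topples G S (toppleAt G η v) l η') : Topples G S η (v :: l) η'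

/-- A configuration is stable if every non-sink vertex has fewer grains than its degree. -/
def Stable (G : SimpleGraph V) (S : Set V) (η : V → ℕ) : Prop :=
  ∀ v, v ∉ S → η v < deg G v

/-- `η` stabilizes to `η'`: there is a legal toppling sequence from `η` to the
stable configuration `η'`. -/
def StabilizesTo (G : SimpleGraph V) (S : Set V) (η η' : V → ℕ) : Prop :=
  ∃ l : List V, Topples G S η l η' ∧ Stable G S η'

/-- A configuration `η` is recurrent if it is stable and, for every configuration `σ`,
there is a configuration `τ` such that `σ + τ` stabilizes to `η` (equality being
required away from the sinks, where grains simply accumulate). -/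
def Recurrent (G : SimpleGraph V) (S : Set V) (η : V → ℕ) : Prop :=
  Stable G S η ∧
    ∀ σ : V → ℕ, ∃ τ η' : V → ℕ, StabilizesTo G S (σ + τ) η' ∧ ∀ v, v ∉ S → η' v = η v

/-- `idf G S v` is the number of edges joining `v` to sink vertices. -/
noncomputable def idf (G : SimpleGraph V) (S : Set V) (v : V) : ℕ :=
  (G.neighborSet v ∩ S).ncard

end ASM

open ASM

/-! ### The graph approximations of the Sierpinski gasket

The level-`n` graph approximation `SG_n` of the Sierpinski gasket is realized in
triangular coordinates: rows `r = 0, …, 2^n` from the top; an upward unit cell with top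
corner `(r, c)` (where `0 ≤ c ≤ r < 2^n`) belongs to the gasket exactly when the binomial
coefficient `r.choose c` is odd, and its three corners are `(r, c)`, `(r+1, c)` and
`(r+1, c+1)`.  Vertices are corners of cells, and two distinct vertices are adjacent
exactly when they are corners of a common cell.  This recovers exactly the recursive
construction: `SG_0` is a triangle, and `SG_{i+1}` consists of three copies of `SG_i`
glued pairwise at corner vertices. -/

/-- `(r, c)` indexes an (upward) cell of the level-`n` Sierpinski gasket graph. -/
def IsCell (n r c : ℕ) : Prop := r < 2 ^ n ∧ c ≤ r ∧ ¬ (2 ∣ Nat.choose r c)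

/-- `(x, y)` is one of the three corners of the cell with top corner `(r, c)`. -/
def InCorners (r c x y : ℕ) : Prop :=
  (x = r ∧ y = c) ∨ (x = r + 1 ∧ y = c) ∨ (x = r + 1 ∧ y = c + 1)

/-- `p` is a vertex of the level-`n` Sierpinski gasket graph. -/
def IsVtx (n : ℕ) (p : ℕ × ℕ) : Prop := ∃ r c : ℕ, IsCell n r c ∧ InCorners r c p.1 p.2

/-- The vertex set of the level-`n` Sierpinski gasket graph `SG_n`. -/
def SGV (n : ℕ) : Type := {p : ℕ × ℕ // IsVtx n p}

/-- The level-`n` Sierpinski gasket graph `SG_n`: two distinct vertices are adjacent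
exactly when they are corners of a common cell. -/
def SGgraph (n : ℕ) : SimpleGraph (SGV n) where
  Adj p q := p ≠ q ∧ ∃ r c : ℕ, IsCell n r c ∧
      InCorners r c p.val.1 p.val.2 ∧ InCorners r c q.val.1 q.val.2
  symm := by constructor; rintro p q ⟨hne, r, c, h1, h2, h3⟩; exact ⟨hne.symm, r, c, h1, h3, h2⟩
  loopless := by constructor; rintro p ⟨hne, -⟩; exact hne rfl

/-- The boundary of `SG_n`: its three corner vertices. -/
def SGBoundary (n : ℕ) : Set (SGV n) :=
  {v | v.val = (0, 0) ∨ v.val = (2 ^ n, 0) ∨ v.val = (2 ^ n, 2 ^ n)}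

/-- The diameter of the set of sites holding sand: the largest graph distance from `v0`
to a vertex carrying at least one grain in the configuration `η`. -/
noncomputable def reachRadius (n : ℕ) (v0 : SGV n) (η : SGV n → ℕ) : ℕ :=
  sSup {d : ℕ | ∃ v : SGV n, 1 ≤ η v ∧ (SGgraph n).dist v0 v = d}


namespace SGL

def c (i j : ℕ) : Prop := Nat.choose (i + j) i % 2 = 1

theorem choose_shift (k N j : ℕ) (hj : j < 2 ^ k) :
    Nat.choose (N + 2 ^ k) j % 2 = Nat.choose N j % 2 := by
  induction N generalizing j with
  | zero =>
    rcases Nat.eq_zero_or_pos j with rfl | h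
    · simp
    · have := Nat.prime_two.dvd_choose_pow (n := k) (k := j) (by omega) (by omega)
      rw [Nat.choose_eq_zero_of_lt h]
      simp only [zero_add]; omega
  | succ N ih =>
    cases j with
    | zero => simp
    | succ j =>
      have e : N + 1 + 2 ^ k = (N + 2 ^ k) + 1 := by ring
      rw [e, Nat.choose_succ_succ, Nat.choose_succ_succ]
      have h1 := ih j (by omega)
      have h2 := ih (j+1) hj
      simp only [Nat.succ_eq_add_one] at *
      omega

theorem c_symm {i j : ℕ} : c i j ↔ c j i := by
  unfold c
  rw [Nat.add_comm i j, Nat.choose_symm_add]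

theorem c_zero_right (i : ℕ) : c i 0 := by simp [c]
theorem c_zero_left (j : ℕ) : c 0 j := by simp [c]

theorem c_shift {k i j : ℕ} (hj : j < 2 ^ k) : c (2 ^ k + i) j ↔ c i j := by
  rw [c_symm, c_symm (i := i)]
  unfold c
  have : j + (2 ^ k + i) = (j + i) + 2 ^ k := by ring
  rw [this, choose_shift k _ _ hj]

theorem c_false {k i j : ℕ} (hi : i < 2 ^ k) (hj : j < 2 ^ k) (h : 2 ^ k ≤ i + j) : ¬ c i j := by
  unfold c
  obtain ⟨s, hs⟩ := Nat.exists_eq_add_of_le h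
  have : i + j = s + 2 ^ k := by omega
  rw [this, choose_shift k _ _ hi, Nat.choose_eq_zero_of_lt (by omega)]
  simp

theorem c_pascal (i j : ℕ) : c (i+1) (j+1) ↔ ¬ (c i (j+1) ↔ c (i+1) j) := by
  unfold c
  have e : i + 1 + (j + 1) = (i + 1 + j) + 1 := by ring
  have e2 : i + (j + 1) = i + 1 + j := by ring
  rw [e, e2, Nat.choose_succ_succ]
  simp only [Nat.succ_eq_add_one]
  omega

noncomputable def nbs (w : ℕ → ℕ → ℕ) (i j : ℕ) : ℕ :=
  (if c i j then w (i+1) j + w i (j+1) else 0)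
  + (if 1 ≤ i ∧ c (i-1) j then w (i-1) j + w (i-1) (j+1) else 0)
  + (if 1 ≤ j ∧ c i (j-1) then w i (j-1) + w (i+1) (j-1) else 0)

theorem nbs_mono {w w' : ℕ → ℕ → ℕ} (h : ∀ i j, w i j ≤ w' i j) (i j : ℕ) :
    nbs w i j ≤ nbs w' i j := by
  unfold nbs
  gcongr <;> split_ifs <;> gcongr <;> apply h

theorem nbs_symm (w : ℕ → ℕ → ℕ) (i j : ℕ) : nbs (fun a b => w b a) i j = nbs w j i := by
  unfold nbs
  simp only [c_symm (i := j), c_symm (i := j - 1)]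
  rw [Nat.add_right_comm, Nat.add_comm (w j (i+1)), ]

/-- `(i,j)` is a point of the triangle of size `2^k` other than the three corners. -/
def Inn (k i j : ℕ) : Prop :=
  i + j ≤ 2 ^ k ∧ ¬ (i = 0 ∧ j = 0) ∧ ¬ (i = 2 ^ k ∧ j = 0) ∧ ¬ (i = 0 ∧ j = 2 ^ k)

def SS (k : ℕ) (w : ℕ → ℕ → ℕ) : Prop := ∀ i j, Inn k i j → nbs w i j ≤ 4 * w i j + 3

structure Lst (k K : ℕ) (w : ℕ → ℕ → ℕ) : Prop where
  w0 : w 0 0 = K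
  wq : w (2 ^ k) 0 = 0
  wr : w 0 (2 ^ k) = 0
  ss : SS k w
  le : ∀ w', K ≤ w' 0 0 → SS k w' → ∀ i j, w i j ≤ w' i j

def IsV (i j : ℕ) : Prop := c i j ∨ (1 ≤ i ∧ c (i-1) j) ∨ (1 ≤ j ∧ c i (j-1))

theorem SS_congr_corner {k : ℕ} {w w' : ℕ → ℕ → ℕ} (hw : SS k w) (hle : ∀ i j, w' i j ≤ w i j)
    (h : ∀ i j, Inn k i j → w' i j = w i j) : SS k w' := by
  intro i j hij
  rw [h i j hij]
  exact (nbs_mono hle i j).trans (hw i j hij)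

theorem exists_lst (k K : ℕ) (w : ℕ → ℕ → ℕ) (hK : K ≤ w 0 0) (hw : SS k w) :
    ∃ v, Lst k K v := by
  let P : (ℕ → ℕ → ℕ) → Prop := fun w => K ≤ w 0 0 ∧ SS k w
  have hex : ∀ i j, ∃ m, ∃ w', P w' ∧ w' i j = m := fun i j => ⟨_, w, ⟨hK, hw⟩, rfl⟩
  let v : ℕ → ℕ → ℕ := fun i j => Nat.find (hex i j)
  have hv : ∀ i j, ∃ w', P w' ∧ w' i j = v i j := fun i j => Nat.find_spec (hex i j)
  have hle : ∀ w', P w' → ∀ i j, v i j ≤ w' i j := fun w' hw' i j =>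
    Nat.find_min' (hex i j) ⟨w', hw', rfl⟩
  have pos : 0 < 2 ^ k := by positivity
  obtain ⟨m, hm1, hm2, hm3⟩ : ∃ m : ℕ → ℕ → ℕ, m 0 0 = K ∧ (∀ i j, Inn k i j → m i j = w i j) ∧
      (∀ i j, ¬ Inn k i j → ¬ (i = 0 ∧ j = 0) → m i j = 0) := by
    refine ⟨fun i j => if Inn k i j then w i j else if i = 0 ∧ j = 0 then K else 0, ?_, ?_, ?_⟩
    · simp [Inn]
    · intro i j h; simp [h]
    · intro i j h h2; simp only [if_neg h, if_neg h2]
  have hmod : P m := by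
    refine ⟨hm1.ge, SS_congr_corner hw ?_ hm2⟩
    intro i j
    by_cases h : Inn k i j
    · exact (hm2 i j h).le
    · by_cases h2 : i = 0 ∧ j = 0
      · obtain ⟨rfl, rfl⟩ := h2; omega
      · rw [hm3 i j h h2]; omega
  refine ⟨v, ?_, ?_, ?_, ?_, fun w' h1 h2 => hle w' ⟨h1, h2⟩⟩
  · apply le_antisymm
    · exact (hle m hmod 0 0).trans hm1.le
    · obtain ⟨w', h1, h2⟩ := hv 0 0
      rw [← h2]; exact h1.1
  · have := hle m hmod (2 ^ k) 0
    rw [hm3 _ _ (by simp [Inn]) (by omega)] at this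
    omega
  · have := hle m hmod 0 (2 ^ k)
    rw [hm3 _ _ (by simp [Inn]) (by omega)] at this
    omega
  · intro i j hij
    obtain ⟨w', h1, h2⟩ := hv i j
    rw [← h2]
    exact (nbs_mono (hle w' h1) i j).trans (h1.2 i j hij)

theorem Inn.symm {k i j : ℕ} (h : Inn k i j) : Inn k j i := by
  unfold Inn at *; omega

theorem Lst.symm {k K : ℕ} {w : ℕ → ℕ → ℕ} (h : Lst k K w) (i j : ℕ) : w i j = w j i := by
  have key : ∀ i j, w i j ≤ w j i := by
    apply h.le (fun i j => w j i)
    · exact h.w0.ge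
    · intro i j hij
      rw [nbs_symm w i j]
      exact h.ss j i hij.symm
  exact le_antisymm (key i j) (key j i)

theorem nbs_le_of {w w' : ℕ → ℕ → ℕ} {i j i' j' : ℕ}
    (h1 : c i j → c i' j' ∧ w (i+1) j ≤ w' (i'+1) j' ∧ w i (j+1) ≤ w' i' (j'+1))
    (h2 : 1 ≤ i → c (i-1) j → (1 ≤ i' ∧ c (i'-1) j') ∧ w (i-1) j ≤ w' (i'-1) j' ∧
       w (i-1) (j+1) ≤ w' (i'-1) (j'+1))
    (h3 : 1 ≤ j → c i (j-1) → (1 ≤ j' ∧ c i' (j'-1)) ∧ w i (j-1) ≤ w' i' (j'-1) ∧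
       w (i+1) (j-1) ≤ w' (i'+1) (j'-1)) :
    nbs w i j ≤ nbs w' i' j' := by
  unfold nbs
  apply add_le_add (add_le_add _ _) _
  · by_cases h : c i j
    · obtain ⟨a, b, d⟩ := h1 h
      rw [if_pos h, if_pos a]; omega
    · rw [if_neg h]; omega
  · by_cases h : 1 ≤ i ∧ c (i-1) j
    · obtain ⟨a, b, d⟩ := h2 h.1 h.2
      rw [if_pos h, if_pos a]; omega
    · rw [if_neg h]; omega
  · by_cases h : 1 ≤ j ∧ c i (j-1)
    · obtain ⟨a, b, d⟩ := h3 h.1 h.2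
      rw [if_pos h, if_pos a]; omega
    · rw [if_neg h]; omega

theorem SS_shift {k : ℕ} {w : ℕ → ℕ → ℕ} (h : SS (k+1) w) :
    SS k (fun i j => w (2 ^ k + i) j) := by
  intro i j hij
  have pos : 0 < 2 ^ k := by positivity
  have hT : Inn (k+1) (2 ^ k + i) j := by unfold Inn at *; rw [pow_succ]; omega
  have hj : j < 2 ^ k := by unfold Inn at hij; omega
  refine le_trans ?_ (h _ _ hT)
  apply nbs_le_of
  · intro hc
    exact ⟨(c_shift hj).2 hc, le_rfl, le_rfl⟩
  · intro hi hc
    have e : 2 ^ k + i - 1 = 2 ^ k + (i - 1) := by omega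
    rw [e]
    exact ⟨⟨by omega, (c_shift hj).2 hc⟩, le_rfl, le_rfl⟩
  · intro h1 hc
    exact ⟨⟨h1, (c_shift (by omega)).2 hc⟩, le_rfl, le_rfl⟩

theorem nbs_q_le {w : ℕ → ℕ → ℕ} {H : ℕ} (pos : 0 < H) :
   w (H-1) 0 + w (H-1) 1 ≤ nbs w H 0 := by
  unfold nbs
  have : 1 ≤ H ∧ c (H-1) 0 := ⟨pos, c_zero_right _⟩
  rw [if_pos this]; simp only [zero_add]; omega


theorem lst_step_A {k K : ℕ} {w wA : ℕ → ℕ → ℕ} (hw : Lst (k+1) K w) (hA : Lst k K wA)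
    (hs : wA (2 ^ k - 1) 0 + wA (2 ^ k - 1) 1 ≤ 3) :
    w (2 ^ (k+1) - 1) 0 + w (2 ^ (k+1) - 1) 1 = 0 := by
  have pos : 0 < 2 ^ k := by positivity
  obtain ⟨H, hH⟩ : ∃ H, H = 2 ^ k := ⟨_, rfl⟩
  have hH2 : 2 ^ (k+1) = 2 * H := by rw [pow_succ, hH]; ring
  obtain ⟨v, hv1, hv2⟩ : ∃ v : ℕ → ℕ → ℕ, (∀ i j, i + j ≤ H → v i j = wA i j) ∧
      (∀ i j, H < i + j → v i j = 0) :=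
    ⟨fun i j => if i + j ≤ H then wA i j else 0, fun i j h => if_pos h,
      fun i j h => if_neg (by omega)⟩
  have hvle : ∀ i j, v i j ≤ wA i j := by
    intro i j
    rcases le_or_gt (i+j) H with h | h
    · exact (hv1 i j h).le
    · rw [hv2 i j h]; omega
  have hvs : ∀ i j, v i j = v j i := by
    intro i j
    rcases le_or_gt (i+j) H with h | h
    · rw [hv1 i j h, hv1 j i (by omega), hA.symm]
    · rw [hv2 i j h, hv2 j i (by omega)]
  rw [← hH] at hs
  have hq := hA.wq
  have hr := hA.wr
  rw [← hH] at hq hr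
  have hqpt : nbs v H 0 ≤ 3 := by
    unfold nbs
    rw [hv2 (H+1) 0 (by omega), hv2 H (0+1) (by omega)]
    have := hvle (H-1) 0
    have := hvle (H-1) (0+1)
    simp only [zero_add] at *
    split_ifs <;> omega
  have hSS : SS (k+1) v := by
    intro i j hij
    rcases le_or_gt (i+j) H with h | h
    · by_cases hI : Inn k i j
      · rw [hv1 i j h]
        exact (nbs_mono hvle i j).trans (hA.ss i j hI)
      · have : (i = H ∧ j = 0) ∨ (i = 0 ∧ j = H) := by
          unfold Inn at hij hI; omega
        rcases this with ⟨rfl, rfl⟩ | ⟨rfl, rfl⟩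
        · omega
        · rw [← nbs_symm]
          have : (fun a b => v b a) = v := by funext a b; exact hvs _ _
          rw [this]; omega
    · have aux : ∀ i j, H < i + j + 1 → c i j → v i j = 0 := by
        intro i j h hc
        rcases Nat.lt_or_ge H (i+j) with h2 | h2
        · exact hv2 i j h2
        · rw [hv1 i j h2]
          by_cases hi : i < H
          · by_cases hj : j < H
            · exact absurd hc (c_false (k := k) (by omega) (by omega) (by omega))
            · have : i = 0 := by omega
              have : j = H := by omega
              subst_vars; assumption
          · have : j = 0 := by omega
            have : i = H := by omega
            subst_vars; assumption
      have : nbs v i j = 0 := by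
        unfold nbs
        rw [hv2 (i+1) j (by omega), hv2 i (j+1) (by omega)]
        have e2 : (if 1 ≤ i ∧ c (i-1) j then v (i-1) j + v (i-1) (j+1) else 0) = 0 := by
          split_ifs with hc
          · rw [aux (i-1) j (by omega) hc.2, hv2 (i-1) (j+1) (by omega)]
          · rfl
        have e3 : (if 1 ≤ j ∧ c i (j-1) then v i (j-1) + v (i+1) (j-1) else 0) = 0 := by
          split_ifs with hc
          · rw [aux i (j-1) (by omega) hc.2, hv2 (i+1) (j-1) (by omega)]
          · rfl
        rw [e2, e3]; simp
      omega
  have hle := hw.le v (by rw [hv1 0 0 (by omega), hA.w0]) hSS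
  rw [hH2]
  have h1 := hle (2 * H - 1) 0
  have h2 := hle (2 * H - 1) 1
  rw [hv2 (2 * H - 1) 1 (by omega)] at h2
  have h3 : v (2 * H - 1) 0 = 0 := by
    rcases Nat.lt_or_ge 1 H with h | h
    · exact hv2 _ _ (by omega)
    · have : 2 * H - 1 = H := by omega
      rw [this, hv1 _ _ (by omega), hq]
  omega

theorem lst_step_B {k K : ℕ} {w wB : ℕ → ℕ → ℕ} (hw : Lst (k+1) K w)
    (hB : Lst k (w (2 ^ k) 0) wB)
    (hs : wB (2 ^ k - 1) 0 + wB (2 ^ k - 1) 1 ≤ 1) :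
    w (2 ^ (k+1) - 1) 0 + w (2 ^ (k+1) - 1) 1 ≤ 1 := by
  have pos : 0 < 2 ^ k := by positivity
  have hBle : ∀ i j, wB i j ≤ w (2 ^ k + i) j := hB.le _ le_rfl (SS_shift hw.ss)
  obtain ⟨H, hH⟩ : ∃ H, H = 2 ^ k := ⟨_, rfl⟩
  have hH2 : 2 ^ (k+1) = 2 * H := by rw [pow_succ, hH]; ring
  obtain ⟨v, hv⟩ : ∃ v : ℕ → ℕ → ℕ, ∀ i j, v i j =
      if H ≤ i then (if i - H + j ≤ H then wB (i - H) j else 0)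
      else if H ≤ j then (if j - H + i ≤ H then wB (j - H) i else 0)
      else w i j := ⟨_, fun i j => rfl⟩
  have hvB : ∀ i j, i + j ≤ H → v (H + i) j = wB i j := by
    intro i j h
    rw [hv, if_pos (by omega), if_pos (by omega)]; congr 1; omega
  have hv0 : ∀ i j, H ≤ i → 2 * H < i + j → v i j = 0 := by
    intro i j h h2
    rw [hv, if_pos h, if_neg (by omega)]
  have hvw : ∀ i j, i < H → j < H → v i j = w i j := by
    intro i j h h2
    rw [hv, if_neg (by omega), if_neg (by omega)]
  have hvs : ∀ i j, v i j = v j i := by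
    intro i j
    rw [hv, hv j i]
    split_ifs
    any_goals omega
    · have : i = H := by omega
      have : j = H := by omega
      subst_vars; rfl
    · exact hw.symm _ _
  have hvle : ∀ i j, v i j ≤ w i j := by
    intro i j
    rw [hv]
    split_ifs with h1 h2 h3 h4
    · have := hBle (i - H) j
      rwa [show 2 ^ k + (i - H) = i by omega] at this
    · omega
    · have := hBle (j - H) i
      rwa [show 2 ^ k + (j - H) = j by omega, hw.symm] at this
    · omega
    · exact le_rfl
  rw [← hH] at hs
  have hq := hB.wq
  have hr := hB.wr
  have h0 := hB.w0
  rw [← hH] at hq hr h0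
  have hSS1 : ∀ i j, H ≤ i → Inn (k+1) i j → nbs v i j ≤ 4 * v i j + 3 := by
    intro i j hi hij
    obtain ⟨i, rfl⟩ := Nat.exists_eq_add_of_le hi
    have hreg : i + j ≤ H := by unfold Inn at hij; omega
    by_cases hI : Inn k i j
    · rw [hvB i j hreg]
      refine le_trans ?_ (hB.ss i j hI)
      have hj : j < 2 ^ k := by unfold Inn at hI; omega
      have hvB' : ∀ i j, v (H + i) j ≤ wB i j := by
        intro i j
        rcases le_or_gt (i + j) H with h | h
        · exact (hvB i j h).le
        · rw [hv0 _ _ (by omega) (by omega)]; omega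
      apply nbs_le_of
      · intro hc
        rw [hH] at hc
        exact ⟨(c_shift hj).1 hc, hvB' (i+1) j, hvB' _ _⟩
      · intro _ hc
        rcases Nat.eq_zero_or_pos i with rfl | h
        · refine absurd hc (c_false (k := k) (by omega) (by omega) ?_)
          unfold Inn at hI; omega
        · have e : H + i - 1 = H + (i - 1) := by omega
          rw [e] at hc ⊢
          refine ⟨⟨h, ?_⟩, hvB' _ _, hvB' _ _⟩
          rw [hH] at hc
          exact (c_shift hj).1 hc
      · intro h1 hc
        rw [hH] at hc
        exact ⟨⟨h1, (c_shift (by omega)).1 hc⟩, hvB' _ _, hvB' (i+1) _⟩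
    · have : (i = 0 ∧ j = 0) ∨ (i = 0 ∧ j = H) := by unfold Inn at hij hI; omega
      rcases this with ⟨rfl, rfl⟩ | ⟨rfl, rfl⟩
      · rw [hvB 0 0 (by omega), h0]
        exact (nbs_mono hvle _ _).trans (hw.ss _ _ hij)
      · have e1 : v (j - 1) j = wB 0 (j-1) := by
          rw [hvs]; exact hvB 0 (j-1) (by omega)
        have e2 : v (j - 1) (j + 1) = wB 1 (j-1) := by
          rw [hvs]; exact hvB 1 (j-1) (by omega)
        have e3 : v j (j - 1) = wB 0 (j-1) := hvB 0 (j-1) (by omega)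
        have e4 : v (j + 1) (j - 1) = wB 1 (j-1) := hvB 1 (j-1) (by omega)
        have e5 := hv0 (j+1) j (by omega) (by omega)
        have e6 := hv0 j (j+1) (by omega) (by omega)
        have s1 := hB.symm 0 (j-1)
        have s2 := hB.symm 1 (j-1)
        simp only [nbs, add_zero, e1, e2, e3, e4, e5, e6]
        split_ifs <;> omega
  have hSS : SS (k+1) v := by
    intro i j hij
    by_cases hi : H ≤ i
    · exact hSS1 i j hi hij
    · by_cases hj : H ≤ j
      · rw [← nbs_symm]
        have : (fun a b => v b a) = v := by funext a b; exact hvs _ _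
        rw [this, hvs i j]
        exact hSS1 j i hj hij.symm
      · rw [hvw i j (by omega) (by omega)]
        exact (nbs_mono hvle _ _).trans (hw.ss _ _ hij)
  have hle := hw.le v (by
    rw [hvw 0 0 (by omega) (by omega), hw.w0]) hSS
  rw [hH2]
  have h1 := hle (2 * H - 1) 0
  have h2 := hle (2 * H - 1) 1
  have e : 2 * H - 1 = H + (H - 1) := by omega
  rw [e] at h1 h2 ⊢
  rw [hvB _ _ (by omega)] at h1 h2
  omega

theorem main_local (k : ℕ) : ∀ (K : ℕ) (w : ℕ → ℕ → ℕ), Lst k K w →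
    2 ≤ w (2 ^ k - 1) 0 + w (2 ^ k - 1) 1 → ∀ i j, Inn k i j → IsV i j → 1 ≤ w i j := by
  induction k with
  | zero =>
    intro K w hw h i j hij
    unfold Inn at hij
    omega
  | succ k ih =>
    intro K w hw h
    have pos : 0 < 2 ^ k := by positivity
    obtain ⟨wA, hA⟩ := exists_lst k K w hw.w0.ge (by
      intro i j hij
      refine hw.ss i j ?_
      unfold Inn at *; rw [pow_succ]; omega)
    have hAle := hA.le w hw.w0.ge (by
      intro i j hij
      refine hw.ss i j ?_
      unfold Inn at *; rw [pow_succ]; omega)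
    have sA : 4 ≤ wA (2 ^ k - 1) 0 + wA (2 ^ k - 1) 1 := by
      by_contra hcon
      have := lst_step_A hw hA (by omega)
      omega
    obtain ⟨wB, hB⟩ := exists_lst k (w (2 ^ k) 0) _ le_rfl (SS_shift hw.ss)
    have hBle : ∀ i j, wB i j ≤ w (2 ^ k + i) j := hB.le _ le_rfl (SS_shift hw.ss)
    have sB : 2 ≤ wB (2 ^ k - 1) 0 + wB (2 ^ k - 1) 1 := by
      by_contra hcon
      have := lst_step_B hw hB (by omega)
      omega
    have iA := ih K wA hA (by omega)
    have iB := ih _ wB hB sB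
    obtain ⟨H, hH⟩ : ∃ H, H = 2 ^ k := ⟨_, rfl⟩
    have hH2 : 2 ^ (k+1) = 2 * H := by rw [pow_succ, hH]; ring
    have hm1 : 1 ≤ w H 0 := by
      have h1 := hw.ss H 0 (by unfold Inn; omega)
      have h2 := nbs_q_le (w := w) (H := H) (by omega)
      have h3 := hAle (H-1) 0
      have h4 := hAle (H-1) 1
      rw [← hH] at sA
      omega
    have hs : 1 ≤ w H H := by
      have h1 := hw.ss H H (by unfold Inn; omega)
      have c1 : c H (H - 1) := by
        have := (c_shift (k := k) (i := 0) (j := H - 1) (by omega)).2 (c_zero_left _)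
        rwa [← hH] at this
      have c2 : c (H - 1) H := c_symm.1 c1
      unfold nbs at h1
      rw [if_pos (show 1 ≤ H ∧ c (H-1) H from ⟨by omega, c2⟩),
        if_pos (show 1 ≤ H ∧ c H (H-1) from ⟨by omega, c1⟩)] at h1
      have e1 := hBle 0 (H-1)
      have e2 := hBle 1 (H-1)
      have s1 := hB.symm 0 (H-1)
      have s2 := hB.symm 1 (H-1)
      have s3 := hw.symm (H-1) H
      have s4 := hw.symm (H-1) (H+1)
      rw [← hH] at e1 e2 sB
      simp only [add_zero] at e1
      omega
    have key : ∀ i j, H ≤ i → Inn (k+1) i j → IsV i j → 1 ≤ w i j := by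
      intro i j hi hij hV
      obtain ⟨i, rfl⟩ := Nat.exists_eq_add_of_le hi
      by_cases hI : Inn k i j
      · have hj : j < 2 ^ k := by unfold Inn at hI; omega
        have : IsV i j := by
          rcases hV with hc | ⟨h1, hc⟩ | ⟨h1, hc⟩
          · rw [hH] at hc
            exact Or.inl ((c_shift hj).1 hc)
          · rcases Nat.eq_zero_or_pos i with rfl | h
            · refine absurd hc (c_false (k := k) (by omega) (by omega) ?_)
              unfold Inn at hI; omega
            · rw [show H + i - 1 = 2 ^ k + (i - 1) by omega] at hc
              exact Or.inr (Or.inl ⟨h, (c_shift hj).1 hc⟩)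
          · rw [hH] at hc
            exact Or.inr (Or.inr ⟨h1, (c_shift (by omega)).1 hc⟩)
        have h1 := iB i j hI this
        have h2 := hBle i j
        rw [hH]; omega
      · have : (i = 0 ∧ j = 0) ∨ (i = 0 ∧ j = H) := by unfold Inn at hij hI; omega
        rcases this with ⟨rfl, rfl⟩ | ⟨rfl, rfl⟩
        · exact hm1
        · exact hs
    intro i j hij hV
    by_cases hi : H ≤ i
    · exact key i j hi hij hV
    by_cases hj : H ≤ j
    · rw [hw.symm]
      refine key j i hj hij.symm ?_
      rcases hV with hc | ⟨h1, hc⟩ | ⟨h1, hc⟩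
      · exact Or.inl (c_symm.1 hc)
      · exact Or.inr (Or.inr ⟨h1, c_symm.1 hc⟩)
      · exact Or.inr (Or.inl ⟨h1, c_symm.1 hc⟩)
    by_cases hsum : i + j ≤ H
    · refine (iA i j ?_ hV).trans (hAle i j)
      unfold Inn at *; omega
    · exfalso
      rcases hV with hc | ⟨h1, hc⟩ | ⟨h1, hc⟩
      · exact c_false (k := k) (by omega) (by omega) (by omega) hc
      · exact c_false (k := k) (by omega) (by omega) (by omega) hc
      · exact c_false (k := k) (by omega) (by omega) (by omega) hc

end SGL

namespace SGL

theorem odometer {V : Type*} (G : SimpleGraph V) (nb : V → Finset V)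
    (hnb : ∀ x y, y ∈ nb x ↔ G.Adj x y) {η η' : V → ℕ} {l : List V}
    (h : Topples G ∅ η l η') :
    ∃ u : V → ℕ, (∀ x, u x = 0 ↔ x ∉ l) ∧
      (∀ x, η' x + deg G x * u x = η x + ∑ y ∈ nb x, u y) ∧
      (∀ W : V → ℕ, (∀ x, η x + ∑ y ∈ nb x, W y < deg G x * (W x + 1)) → ∀ x, u x ≤ W x) := by
  induction h with
  | nil η => exact ⟨fun _ => 0, by simp, by simp, by simp⟩
  | @cons η η' l v hv hge ht ih =>
    obtain ⟨u, h1, h2, h3⟩ := ih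
    refine ⟨fun x => u x + if x = v then 1 else 0, ?_, ?_, ?_⟩
    · intro x
      have := h1 x
      by_cases hx : x = v
      · simp [hx]
      · simp [hx, this]
    · intro x
      have := h2 x
      rw [Finset.sum_add_distrib, Finset.sum_ite_eq']
      by_cases hx : x = v
      · subst hx
        have hn : x ∉ nb x := by rw [hnb]; exact G.loopless.irrefl x
        simp only [toppleAt, if_true] at this
        rw [if_neg hn]
        simp only [if_true, mul_add, mul_one]
        omega
      · simp only [toppleAt, if_neg hx] at this
        have e : v ∈ nb x ↔ G.Adj v x := by rw [hnb, G.adj_comm]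
        simp only [if_neg hx, e, add_zero]
        omega
    · intro W hW
      have hWv : 1 ≤ W v := by
        by_contra hcon
        have h0 : W v = 0 := by omega
        have := hW v
        rw [h0] at this
        omega
      have := h3 (fun x => W x - if x = v then 1 else 0) ?_
      · intro x
        have h4 := this x
        dsimp only at h4 ⊢
        split_ifs at h4 ⊢ with hx
        · subst hx; omega
        · omega
      · intro x
        have hx := hW x
        have hsum : ∑ y ∈ nb x, W y = ∑ y ∈ nb x, (W y - if y = v then 1 else 0)
            + if v ∈ nb x then 1 else 0 := by
          rw [← Finset.sum_ite_eq' (nb x) v (fun _ => 1), ← Finset.sum_add_distrib]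
          apply Finset.sum_congr rfl
          intro y _
          split_ifs with hy
          · subst hy; omega
          · omega
        by_cases hxv : x = v
        · subst hxv
          have hn : x ∉ nb x := by rw [hnb]; exact G.loopless.irrefl x
          rw [if_neg hn] at hsum
          simp only [toppleAt, if_true]
          have : W x = (W x - 1) + 1 := by omega
          rw [this, mul_add] at hx
          omega
        · have e : v ∈ nb x ↔ G.Adj v x := by rw [hnb, G.adj_comm]
          simp only [e] at hsum
          simp only [toppleAt, if_neg hxv]
          simp only [Nat.sub_zero]
          omega

/-- Sum over the neighbours, cell by cell. -/
noncomputable def GN (n : ℕ) (f : ℕ → ℕ → ℕ) (a b : ℕ) : ℕ :=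
  (if IsCell n a b then f (a+1) b + f (a+1) (b+1) else 0)
  + (if 1 ≤ a ∧ IsCell n (a-1) b then f (a-1) b + f a (b+1) else 0)
  + (if (1 ≤ a ∧ 1 ≤ b) ∧ IsCell n (a-1) (b-1) then f (a-1) (b-1) + f a (b-1) else 0)

noncomputable def NF (n : ℕ) (a b : ℕ) : Finset (ℕ × ℕ) :=
  (if IsCell n a b then {(a+1, b), (a+1, b+1)} else ∅)
  ∪ (if 1 ≤ a ∧ IsCell n (a-1) b then {(a-1, b), (a, b+1)} else ∅)
  ∪ (if (1 ≤ a ∧ 1 ≤ b) ∧ IsCell n (a-1) (b-1) then {(a-1, b-1), (a, b-1)} else ∅)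

theorem sum_NF (n : ℕ) (f : ℕ → ℕ → ℕ) (a b : ℕ) :
    ∑ p ∈ NF n a b, f p.1 p.2 = GN n f a b := by
  unfold NF GN
  rw [Finset.sum_union, Finset.sum_union]
  · congr 1
    · congr 1
      · split_ifs
        · rw [Finset.sum_pair (by simp)]
        · simp
      · split_ifs with h
        · rw [Finset.sum_pair (by simp)]
        · simp
    · split_ifs with h
      · rw [Finset.sum_pair (by simp; omega)]
      · simp
  · rw [Finset.disjoint_left]
    rintro ⟨x, y⟩ h1 h2
    split_ifs at h1 h2 <;> simp at h1 h2
    omega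
  · rw [Finset.disjoint_left]
    rintro ⟨x, y⟩ h1 h2
    split_ifs at h1 h2 <;> simp at h1 h2 <;> omega

theorem mem_NF {n a b x y : ℕ} : (x, y) ∈ NF n a b ↔
    (x, y) ≠ (a, b) ∧ ∃ r c, IsCell n r c ∧ InCorners r c a b ∧ InCorners r c x y := by
  unfold NF
  constructor
  · intro h
    simp only [Finset.mem_union] at h
    rcases h with (h | h) | h
    · split_ifs at h with hc
      · simp only [Finset.mem_insert, Finset.mem_singleton, Prod.mk.injEq] at h
        refine ⟨by simp; omega, a, b, hc, ?_, ?_⟩ <;> unfold InCorners <;> omega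
      · simp at h
    · split_ifs at h with hc
      · simp only [Finset.mem_insert, Finset.mem_singleton, Prod.mk.injEq] at h
        refine ⟨by simp; omega, _, _, hc.2, ?_, ?_⟩ <;> unfold InCorners <;> omega
      · simp at h
    · split_ifs at h with hc
      · simp only [Finset.mem_insert, Finset.mem_singleton, Prod.mk.injEq] at h
        refine ⟨by simp; omega, _, _, hc.2, ?_, ?_⟩ <;> unfold InCorners <;> omega
      · simp at h
  · rintro ⟨hne, r, d, hc, h1, h2⟩
    simp only [ne_eq, Prod.mk.injEq] at hne
    simp only [Finset.mem_union]
    rcases h1 with ⟨rfl, rfl⟩ | ⟨rfl, rfl⟩ | ⟨rfl, rfl⟩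
    · left; left
      rw [if_pos hc]
      simp only [Finset.mem_insert, Finset.mem_singleton, Prod.mk.injEq]
      unfold InCorners at h2; omega
    · left; right
      rw [if_pos ⟨by omega, hc⟩]
      simp only [Finset.mem_insert, Finset.mem_singleton, Prod.mk.injEq]
      unfold InCorners at h2; omega
    · right
      rw [if_pos ⟨⟨by omega, by omega⟩, hc⟩]
      simp only [Finset.mem_insert, Finset.mem_singleton, Prod.mk.injEq]
      unfold InCorners at h2; omega

theorem NF_vtx {n a b : ℕ} {p : ℕ × ℕ} (h : p ∈ NF n a b) : IsVtx n p := by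
  obtain ⟨x, y⟩ := p
  obtain ⟨_, r, d, hc, _, h2⟩ := mem_NF.1 h
  exact ⟨r, d, hc, h2⟩

def mkV (n : ℕ) (p : ℕ × ℕ) (h : IsVtx n p) : SGV n := ⟨p, h⟩

def pv {n : ℕ} (x : SGV n) : ℕ × ℕ := x.val

theorem pv_vtx {n : ℕ} (x : SGV n) : IsVtx n (pv x) := x.2

theorem pv_mk {n : ℕ} (p : ℕ × ℕ) (h : IsVtx n p) : pv (mkV n p h) = p := rfl

theorem pv_inj {n : ℕ} {x y : SGV n} (h : pv x = pv y) : x = y := Subtype.ext h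

theorem mk_pv {n : ℕ} (x : SGV n) (h : IsVtx n (pv x)) : mkV n (pv x) h = x := rfl

theorem adj_iff {n : ℕ} {x y : SGV n} : (SGgraph n).Adj x y ↔ x ≠ y ∧ ∃ r c : ℕ, IsCell n r c ∧
      InCorners r c (pv x).1 (pv x).2 ∧ InCorners r c (pv y).1 (pv y).2 := Iff.rfl

noncomputable def nb (n : ℕ) (x : SGV n) : Finset (SGV n) :=
  (NF n (pv x).1 (pv x).2).attach.image (fun p => mkV n p.1 (NF_vtx p.2))

theorem mem_nb (n : ℕ) (x y : SGV n) : y ∈ nb n x ↔ (SGgraph n).Adj x y := by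
  have h1 : y ∈ nb n x ↔ pv y ∈ NF n (pv x).1 (pv x).2 := by
    unfold nb
    constructor
    · intro h
      rw [Finset.mem_image] at h
      obtain ⟨p, _, rfl⟩ := h
      exact p.2
    · intro h
      rw [Finset.mem_image]
      exact ⟨⟨pv y, h⟩, Finset.mem_attach _ _, rfl⟩
  rw [h1, show pv y = ((pv y).1, (pv y).2) from rfl, mem_NF, adj_iff]
  apply and_congr
  · constructor
    · rintro h rfl; exact h rfl
    · intro h h2; exact h (pv_inj h2.symm)
  · rfl

theorem sum_nb (n : ℕ) (f : ℕ → ℕ → ℕ) (x : SGV n) :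
    ∑ y ∈ nb n x, f (pv y).1 (pv y).2 = GN n f (pv x).1 (pv x).2 := by
  unfold nb
  rw [Finset.sum_image]
  · rw [← sum_NF]
    exact Finset.sum_attach (NF n (pv x).1 (pv x).2) (fun p => f p.1 p.2)
  · intro p _ q _ h
    exact Subtype.ext (congrArg pv h)

theorem deg_eq (n : ℕ) (x : SGV n) :
    deg (SGgraph n) x = GN n (fun _ _ => 1) (pv x).1 (pv x).2 := by
  rw [← sum_nb, Finset.sum_const, smul_eq_mul, mul_one]
  unfold deg
  rw [← Set.ncard_coe_finset]
  congr 1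
  ext y
  simp [mem_nb]

noncomputable def extd (n : ℕ) (u : SGV n → ℕ) (a b : ℕ) : ℕ :=
  if h : IsVtx n (a, b) then u (mkV n (a, b) h) else 0

theorem extd_val (n : ℕ) (u : SGV n → ℕ) (x : SGV n) : extd n u (pv x).1 (pv x).2 = u x := by
  unfold extd
  exact dif_pos (pv_vtx x)

structure Good (n N : ℕ) (U E : ℕ → ℕ → ℕ) : Prop where
  eq : ∀ a b, IsVtx n (a, b) → E a b + GN n (fun _ _ => 1) a b * U a b =
    (if a = 2 ^ n ∧ b = 2 ^ (n-1) then N else 0) + GN n U a b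
  st : ∀ a b, IsVtx n (a, b) → E a b < GN n (fun _ _ => 1) a b

theorem to_good (n N : ℕ) (v0 : SGV n) (hv0 : pv v0 = (2 ^ n, 2 ^ (n - 1)))
    (l : List (SGV n)) (η' : SGV n → ℕ)
    (hl : Topples (SGgraph n) ∅ (fun v => if v = v0 then N else 0) l η')
    (hstable : Stable (SGgraph n) ∅ η') :
    ∃ U E : ℕ → ℕ → ℕ, Good n N U E ∧ (∀ x : SGV n, U (pv x).1 (pv x).2 = 0 ↔ x ∉ l) ∧
      (∀ x : SGV n, E (pv x).1 (pv x).2 = η' x) ∧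
      (∀ W : ℕ → ℕ → ℕ, (∀ a b, IsVtx n (a, b) →
        (if a = 2 ^ n ∧ b = 2 ^ (n-1) then N else 0) + GN n W a b
          < GN n (fun _ _ => 1) a b * (W a b + 1)) → ∀ a b, IsVtx n (a, b) → U a b ≤ W a b) := by
  obtain ⟨u, h1, h2, h3⟩ := odometer (SGgraph n) (nb n) (mem_nb n) hl
  have e0 : ∀ x : SGV n, (x = v0) ↔ ((pv x).1 = 2 ^ n ∧ (pv x).2 = 2 ^ (n-1)) := by
    intro x
    constructor
    · rintro rfl
      rw [hv0]; simp
    · rintro ⟨h1, h2⟩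
      apply pv_inj
      rw [hv0, ← h1, ← h2]
  have hx : ∀ a b, IsVtx n (a, b) → ∃ x : SGV n, a = (pv x).1 ∧ b = (pv x).2 :=
    fun a b h => ⟨mkV n (a, b) h, rfl, rfl⟩
  refine ⟨extd n u, extd n η', ⟨?_, ?_⟩, ?_, extd_val n η', ?_⟩
  · intro a b h
    obtain ⟨x, rfl, rfl⟩ := hx a b h
    have := h2 x
    have s : ∑ y ∈ nb n x, u y = GN n (extd n u) (pv x).1 (pv x).2 := by
      rw [← sum_nb n (extd n u) x]
      exact Finset.sum_congr rfl (fun y _ => (extd_val n u y).symm)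
    rw [s, deg_eq] at this
    simp only [e0] at this
    rw [extd_val, extd_val]
    exact this
  · intro a b h
    obtain ⟨x, rfl, rfl⟩ := hx a b h
    have := hstable x (by simp)
    rw [deg_eq] at this
    rw [extd_val]
    exact this
  · intro x
    rw [extd_val]; exact h1 x
  · intro W hW a b h
    obtain ⟨x, rfl, rfl⟩ := hx a b h
    rw [extd_val]
    refine h3 (fun x => W (pv x).1 (pv x).2) ?_ x
    intro x
    have hx := hW _ _ (pv_vtx x)
    rw [sum_nb, deg_eq]
    simp only [e0]
    exact hx

end SGL

namespace SGL

theorem isCell_iff {m r d : ℕ} :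
    IsCell (m+1) r d ↔ r < 2 * 2 ^ m ∧ d ≤ r ∧ Nat.choose r d % 2 = 1 := by
  unfold IsCell
  rw [pow_succ, mul_comm]
  have : ¬ 2 ∣ r.choose d ↔ r.choose d % 2 = 1 := by omega
  rw [this]

theorem cell_refl {n r d : ℕ} (h : IsCell n r d) : IsCell n r (r - d) := by
  obtain ⟨h1, h2, h3⟩ := h
  exact ⟨h1, by omega, by rwa [Nat.choose_symm h2]⟩

theorem cell_refl_iff {n r d : ℕ} (hd : d ≤ r) : IsCell n r (r - d) ↔ IsCell n r d := by
  constructor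
  · intro h
    have := cell_refl h
    rwa [Nat.sub_sub_self hd] at this
  · exact cell_refl

theorem choose_neg (m j : ℕ) : ∀ i, i + j < 2 ^ m →
    Nat.choose (2 ^ m - 1 - j) i % 2 = Nat.choose (i + j) i % 2 := by
  induction j with
  | zero =>
    intro i
    induction i with
    | zero => simp
    | succ i ih =>
      intro h
      have h1 := ih (by omega)
      have h2 := Nat.prime_two.dvd_choose_pow (n := m) (k := i+1) (by omega) (by omega)
      rw [show 2 ^ m = (2 ^ m - 1) + 1 by omega, Nat.choose_succ_succ] at h2
      simp only [Nat.sub_zero, add_zero, Nat.choose_self, Nat.succ_eq_add_one] at *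
      omega
  | succ j ihj =>
    intro i
    induction i with
    | zero => simp
    | succ i ih =>
      intro h
      have h1 := ih (by omega)
      have h2 := ihj (i+1) (by omega)
      rw [show 2 ^ m - 1 - j = (2 ^ m - 1 - (j+1)) + 1 by omega, Nat.choose_succ_succ] at h2
      rw [show i + 1 + (j + 1) = (i + (j+1)) + 1 by omega, Nat.choose_succ_succ]
      rw [show i + 1 + j = i + (j+1) by omega] at h2
      simp only [Nat.succ_eq_add_one] at *
      omega

theorem G1 {m i j : ℕ} (h : i + j < 2 ^ m) :
    IsCell (m+1) (2 * 2 ^ m - 1 - j) (2 ^ m + i) ↔ c i j := by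
  rw [isCell_iff]
  have e : Nat.choose (2 * 2 ^ m - 1 - j) (2 ^ m + i) % 2 = Nat.choose (i + j) i % 2 := by
    rw [← choose_neg m j i h, ← Nat.choose_symm (show i ≤ 2 ^ m - 1 - j by omega),
      ← choose_shift m (2 ^ m - 1 - j) (2 ^ m - 1 - j - i) (by omega),
      ← Nat.choose_symm (show 2 ^ m - 1 - j - i ≤ 2 ^ m - 1 - j + 2 ^ m by omega)]
    congr 2 <;> omega
  rw [e]
  unfold c
  constructor
  · exact fun h => h.2.2
  · exact fun h => ⟨by omega, by omega, h⟩

theorem G2 {m j : ℕ} (h1 : 1 ≤ j) (h : j < 2 ^ m) :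
    ¬ IsCell (m+1) (2 * 2 ^ m - 1 - j) (2 ^ m - 1) := by
  rw [isCell_iff]
  rintro ⟨_, _, h3⟩
  rw [show 2 * 2 ^ m - 1 - j = (2 ^ m - 1 - j) + 2 ^ m by omega,
    choose_shift m _ _ (by omega), Nat.choose_eq_zero_of_lt (by omega)] at h3
  simp at h3

theorem GN_nbs {m J i j : ℕ} (hJ : J ≤ m) (hI : Inn J i j) (f : ℕ → ℕ → ℕ) :
    GN (m+1) f (2 * 2 ^ m - j) (2 ^ m + i) = nbs (fun i j => f (2 * 2 ^ m - j) (2 ^ m + i)) i j := by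
  have hp : 2 ^ J ≤ 2 ^ m := Nat.pow_le_pow_right (by norm_num) hJ
  have pos : 0 < 2 ^ J := by positivity
  have hI' := hI
  unfold Inn at hI
  unfold GN nbs
  have t1 : (if IsCell (m+1) (2 * 2 ^ m - j) (2 ^ m + i) then
      f (2 * 2 ^ m - j + 1) (2 ^ m + i) + f (2 * 2 ^ m - j + 1) (2 ^ m + i + 1) else 0) =
      (if 1 ≤ j ∧ c i (j-1) then f (2 * 2 ^ m - (j-1)) (2 ^ m + i)
        + f (2 * 2 ^ m - (j-1)) (2 ^ m + (i+1)) else 0) := by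
    rcases Nat.eq_zero_or_pos j with rfl | hj
    · rw [if_neg (by rw [isCell_iff]; omega), if_neg (by omega)]
    · have := G1 (m := m) (i := i) (j := j - 1) (by omega)
      rw [show 2 * 2 ^ m - 1 - (j - 1) = 2 * 2 ^ m - j by omega] at this
      rw [show 2 * 2 ^ m - (j - 1) = 2 * 2 ^ m - j + 1 by omega]
      simp only [this, show (1 ≤ j) = True from eq_true hj, true_and]
      rfl
  have t2 : (if 1 ≤ 2 * 2 ^ m - j ∧ IsCell (m+1) (2 * 2 ^ m - j - 1) (2 ^ m + i) then
      f (2 * 2 ^ m - j - 1) (2 ^ m + i) + f (2 * 2 ^ m - j) (2 ^ m + i + 1) else 0) =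
      (if c i j then f (2 * 2 ^ m - j) (2 ^ m + (i+1)) + f (2 * 2 ^ m - (j+1)) (2 ^ m + i) else 0) := by
    have e1 : (1 ≤ 2 * 2 ^ m - j) = True := eq_true (by omega)
    simp only [e1, true_and]
    by_cases h : i + j < 2 ^ m
    · have := G1 (m := m) h
      rw [show 2 * 2 ^ m - 1 - j = 2 * 2 ^ m - j - 1 by omega] at this
      simp only [this]
      rw [show 2 * 2 ^ m - (j+1) = 2 * 2 ^ m - j - 1 by omega, Nat.add_comm (f (2 * 2 ^ m - j) _)]
      rfl
    · rw [if_neg (by rw [isCell_iff]; omega), if_neg (c_false (k := m) (by omega) (by omega) (by omega))]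
  have t3 : (if (1 ≤ 2 * 2 ^ m - j ∧ 1 ≤ 2 ^ m + i) ∧
      IsCell (m+1) (2 * 2 ^ m - j - 1) (2 ^ m + i - 1) then
      f (2 * 2 ^ m - j - 1) (2 ^ m + i - 1) + f (2 * 2 ^ m - j) (2 ^ m + i - 1) else 0) =
      (if 1 ≤ i ∧ c (i-1) j then f (2 * 2 ^ m - j) (2 ^ m + (i-1))
        + f (2 * 2 ^ m - (j+1)) (2 ^ m + (i-1)) else 0) := by
    have e1 : (1 ≤ 2 * 2 ^ m - j ∧ 1 ≤ 2 ^ m + i) = True := eq_true (by omega)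
    simp only [e1, true_and]
    rcases Nat.eq_zero_or_pos i with rfl | hi
    · rw [if_neg, if_neg (by omega)]
      have := G2 (m := m) (j := j) (by omega) (by omega)
      rw [show 2 * 2 ^ m - 1 - j = 2 * 2 ^ m - j - 1 by omega] at this
      exact this
    · have := G1 (m := m) (i := i - 1) (j := j) (by omega)
      rw [show 2 * 2 ^ m - 1 - j = 2 * 2 ^ m - j - 1 by omega,
        show 2 ^ m + (i - 1) = 2 ^ m + i - 1 by omega] at this
      rw [show 2 * 2 ^ m - (j+1) = 2 * 2 ^ m - j - 1 by omega,
        show 2 ^ m + (i - 1) = 2 ^ m + i - 1 by omega]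
      simp only [this, show (1 ≤ i) = True from eq_true hi, true_and]
      rw [Nat.add_comm]
  rw [t1, t2, t3]
  ring

theorem nbs_one {i j : ℕ} (h0 : ¬ (i = 0 ∧ j = 0)) (h : IsV i j) : nbs (fun _ _ => 1) i j = 4 := by
  unfold nbs
  unfold IsV at h
  rcases i with _ | i
  · rcases j with _ | j
    · simp at h0
    · simp [c_zero_left]
  · rcases j with _ | j
    · simp [c_zero_right]
    · have := c_pascal i j
      simp only [Nat.add_sub_cancel] at *
      by_cases h1 : c i (j+1) <;> by_cases h2 : c (i+1) j <;> by_cases h3 : c (i+1) (j+1) <;>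
        simp [h1, h2, h3] at * 

theorem nbs_zero {i j : ℕ} (w : ℕ → ℕ → ℕ) (h : ¬ IsV i j) : nbs w i j = 0 := by
  unfold nbs
  unfold IsV at h
  push Not at h
  rw [if_neg h.1, if_neg (by tauto), if_neg (by tauto)]

theorem GN_pos {n a b : ℕ} (h : IsVtx n (a, b)) : 2 ≤ GN n (fun _ _ => 1) a b := by
  obtain ⟨r, d, hc, h⟩ := h
  unfold GN
  beta_reduce
  rcases h with ⟨h1, h2⟩ | ⟨h1, h2⟩ | ⟨h1, h2⟩ <;> dsimp only at h1 h2 <;> subst h1 h2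
  · rw [if_pos hc]; omega
  · rw [if_pos (show 1 ≤ r + 1 ∧ IsCell n (r+1-1) _ from ⟨by omega, hc⟩)]; omega
  · rw [if_pos (show (1 ≤ r + 1 ∧ 1 ≤ d + 1) ∧ IsCell n (r+1-1) (d+1-1) from ⟨by omega, hc⟩)]; omega

theorem GN_vtx {n a b : ℕ} {f : ℕ → ℕ → ℕ} (h : 0 < GN n f a b) : IsVtx n (a, b) := by
  unfold GN at h
  by_cases h1 : IsCell n a b
  · exact ⟨a, b, h1, by unfold InCorners; simp⟩
  by_cases h2 : 1 ≤ a ∧ IsCell n (a-1) b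
  · exact ⟨a-1, b, h2.2, by unfold InCorners; simp; omega⟩
  by_cases h3 : (1 ≤ a ∧ 1 ≤ b) ∧ IsCell n (a-1) (b-1)
  · exact ⟨a-1, b-1, h3.2, by unfold InCorners; simp; omega⟩
  rw [if_neg h1, if_neg h2, if_neg h3] at h
  simp at h

theorem GN_le_four (m a b : ℕ) : GN (m+1) (fun _ _ => 1) a b ≤ 4 := by
  unfold GN
  beta_reduce
  by_cases h1 : IsCell (m+1) a b
  · by_cases h2 : 1 ≤ a ∧ IsCell (m+1) (a-1) b
    · by_cases h3 : (1 ≤ a ∧ 1 ≤ b) ∧ IsCell (m+1) (a-1) (b-1)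
      · exfalso
        rw [isCell_iff] at h1 h2 h3
        obtain ⟨a, rfl⟩ := Nat.exists_eq_succ_of_ne_zero (show a ≠ 0 by omega)
        obtain ⟨b, rfl⟩ := Nat.exists_eq_succ_of_ne_zero (show b ≠ 0 by omega)
        rw [Nat.choose_succ_succ] at h1
        simp only [Nat.succ_eq_add_one, Nat.add_sub_cancel] at *
        omega
      · rw [if_neg h3]; split_ifs <;> omega
    · rw [if_neg h2]; split_ifs <;> omega
  · rw [if_neg h1]; split_ifs <;> omega

theorem GN_mono {n : ℕ} {f g : ℕ → ℕ → ℕ} (h : ∀ a b, f a b ≤ g a b) (a b : ℕ) :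
    GN n f a b ≤ GN n g a b := by
  unfold GN
  gcongr <;> split_ifs <;> gcongr <;> apply h

theorem GN_refl {n a b : ℕ} (hb : b ≤ a) (f : ℕ → ℕ → ℕ) :
    GN n (fun a b => f a (a - b)) a b = GN n f a (a - b) := by
  unfold GN
  have t1 : (if IsCell n a b then f (a+1) (a+1-b) + f (a+1) (a+1-(b+1)) else 0) =
      (if IsCell n a (a-b) then f (a+1) (a-b) + f (a+1) (a-b+1) else 0) := by
    simp only [cell_refl_iff hb]
    rw [show a + 1 - (b+1) = a - b by omega, show a + 1 - b = a - b + 1 by omega, Nat.add_comm (f _ _)]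
  have t2 : (if 1 ≤ a ∧ IsCell n (a-1) b then f (a-1) (a-1-b) + f a (a-(b+1)) else 0) =
      (if (1 ≤ a ∧ 1 ≤ a - b) ∧ IsCell n (a-1) (a-b-1) then f (a-1) (a-b-1) + f a (a-b-1) else 0) := by
    by_cases h : b < a
    · have := cell_refl_iff (n := n) (show b ≤ a - 1 by omega)
      rw [show a - 1 - b = a - b - 1 by omega] at *
      simp only [this, eq_true (show 1 ≤ a by omega), eq_true (show 1 ≤ a - b by omega), true_and]
      rfl
    · rw [if_neg, if_neg]
      · omega
      · unfold IsCell; omega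
  have t3 : (if (1 ≤ a ∧ 1 ≤ b) ∧ IsCell n (a-1) (b-1) then f (a-1) (a-1-(b-1)) + f a (a-(b-1)) else 0) =
      (if 1 ≤ a ∧ IsCell n (a-1) (a-b) then f (a-1) (a-b) + f a (a-b+1) else 0) := by
    by_cases h : 1 ≤ b
    · have := cell_refl_iff (n := n) (show b - 1 ≤ a - 1 by omega)
      rw [show a - 1 - (b - 1) = a - b by omega] at *
      rw [show a - (b - 1) = a - b + 1 by omega]
      simp only [this, h, and_true]
    · rw [if_neg, if_neg]
      · unfold IsCell; omega
      · omega
  rw [t1, t2, t3]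
  ring

theorem corners_refl {r d a b : ℕ} (hd : d ≤ r) (h : InCorners r d a b) :
    b ≤ a ∧ InCorners r (r - d) a (a - b) := by
  unfold InCorners at *; omega

theorem vtx_refl {n a b : ℕ} (h : IsVtx n (a, b)) : b ≤ a ∧ IsVtx n (a, a - b) := by
  obtain ⟨r, d, hc, h⟩ := h
  have := corners_refl hc.2.1 h
  exact ⟨this.1, r, r - d, cell_refl hc, this.2⟩

theorem Good.refl {m N : ℕ} {U E : ℕ → ℕ → ℕ} (h : Good (m+1) N U E) :
    Good (m+1) N (fun a b => U a (a - b)) (fun a b => E a (a - b)) := by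
  constructor
  · intro a b hv
    obtain ⟨hb, hv'⟩ := vtx_refl hv
    have := h.eq a (a - b) hv'
    rw [GN_refl hb]
    rw [← GN_refl hb (fun _ _ => 1)] at this
    rw [this]
    congr 1
    have : (a = 2 ^ (m+1) ∧ a - b = 2 ^ (m+1-1)) ↔ (a = 2 ^ (m+1) ∧ b = 2 ^ (m+1-1)) := by
      simp only [Nat.add_sub_cancel]; rw [pow_succ]; omega
    simp only [this]
  · intro a b hv
    obtain ⟨hb, hv'⟩ := vtx_refl hv
    have := h.st a (a - b) hv'
    rw [← GN_refl hb (fun _ _ => 1)] at this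
    exact this

theorem inn_vtx {m J i j : ℕ} (hJ : J ≤ m) (hI : Inn J i j) :
    IsVtx (m+1) (2 * 2 ^ m - j, 2 ^ m + i) ↔ IsV i j := by
  have e := GN_nbs hJ hI (fun _ _ => 1)
  constructor
  · intro h
    by_contra hc
    have := GN_pos h
    rw [e, nbs_zero _ hc] at this
    omega
  · intro h
    have h4 := nbs_one (by unfold Inn at hI; tauto) h
    apply GN_vtx (f := fun _ _ => 1)
    rw [e, h4]; norm_num

theorem Good.ss {m N J : ℕ} {U E : ℕ → ℕ → ℕ} (h : Good (m+1) N U E) (hJ : J ≤ m) :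
    SS J (fun i j => U (2 * 2 ^ m - j) (2 ^ m + i)) := by
  intro i j hI
  by_cases hV : IsV i j
  · have hv := (inn_vtx hJ hI).2 hV
    have h1 := h.eq _ _ hv
    have h2 := h.st _ _ hv
    rw [GN_nbs hJ hI, GN_nbs hJ hI] at h1
    rw [GN_nbs hJ hI] at h2
    have h4 := nbs_one (by unfold Inn at hI; tauto) hV
    rw [h4] at h1 h2
    show _ ≤ 4 * U (2 * 2 ^ m - j) (2 ^ m + i) + 3
    omega
  · rw [nbs_zero _ hV]; omega

end SGL

namespace SGL

def inR (m h a b : ℕ) : Prop := 2 ^ m ≤ b ∧ b ≤ a ∧ a ≤ 2 * 2 ^ m ∧ b + 2 ^ m ≤ a + h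

def inL (m h a b : ℕ) : Prop := b ≤ a ∧ inR m h a (a - b)

def TT (m h a b : ℕ) : Prop := inR m h a b ∨ inL m h a b

def CR (m h r d : ℕ) : Prop := 2 ^ m ≤ d ∧ d ≤ r ∧ r < 2 * 2 ^ m ∧ d + 2 ^ m ≤ r + h

theorem TT.refl {m k a b : ℕ} (h : TT m k a b) : TT m k a (a - b) := by
  rcases h with h | h
  · right
    refine ⟨by omega, ?_⟩
    rwa [Nat.sub_sub_self h.2.1]
  · left; exact h.2

theorem cr_in {m h r d a b : ℕ} (hc : CR m h r d) (hI : InCorners r d a b) : inR m h a b := by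
  unfold CR at hc; unfold InCorners at hI; unfold inR; omega

theorem crt_in {m h r d a b : ℕ} (hd : d ≤ r) (hc : CR m h r d ∨ CR m h r (r - d))
    (hI : InCorners r d a b) : TT m h a b := by
  rcases hc with hc | hc
  · exact Or.inl (cr_in hc hI)
  · obtain ⟨h1, h2⟩ := corners_refl hd hI
    exact Or.inr ⟨h1, cr_in hc h2⟩

theorem cell_r1 {m h r d a b : ℕ} (hc : IsCell (m+1) r d) (hI : InCorners r d a b)
    (hR : inR m h a b) (hh : h < 2 ^ m) : CR m (h+1) r d ∨ CR m (h+1) r (r - d) := by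
  have hc' := isCell_iff.1 hc
  unfold CR; unfold inR at hR
  rcases hI with ⟨h1, h2⟩ | ⟨h1, h2⟩ | ⟨h1, h2⟩
  · omega
  · omega
  · by_cases hd : 2 ^ m ≤ d
    · omega
    · have e : d = 2 ^ m - 1 := by omega
      by_cases hj : r = 2 * 2 ^ m - 1
      · omega
      · exfalso
        refine G2 (m := m) (j := 2 * 2 ^ m - 1 - r) (by omega) (by omega) ?_
        rwa [show 2 * 2 ^ m - 1 - (2 * 2 ^ m - 1 - r) = r by omega, ← e]

theorem cell_r2 {m J r d a b : ℕ} (hJ : J ≤ m) (hc : IsCell (m+1) r d) (hI : InCorners r d a b)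
    (hR : inR m (2^J) a b) (n1 : ¬ (a = 2 * 2 ^ m ∧ b = 2 ^ m + 2 ^ J))
    (n2 : ¬ (a = 2 * 2 ^ m - 2 ^ J ∧ b = 2 ^ m)) :
    CR m (2^J) r d ∨ CR m (2^J) r (r - d) := by
  have hp : 2 ^ J ≤ 2 ^ m := Nat.pow_le_pow_right (by norm_num) hJ
  have pos : 0 < 2 ^ J := by positivity
  have hc' := isCell_iff.1 hc
  by_cases hl : b + 2 ^ m < a + 2 ^ J
  · have := cell_r1 (h := 2 ^ J - 1) hc hI (by unfold inR at *; omega) (by omega)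
    rwa [Nat.sub_add_cancel pos] at this
  · left
    unfold CR; unfold inR at hR
    rcases hI with ⟨h1, h2⟩ | ⟨h1, h2⟩ | ⟨h1, h2⟩
    · omega
    · exfalso
      obtain ⟨i, rfl⟩ := Nat.exists_eq_add_of_le hR.1
      have hi : i + (2 * 2 ^ m - a) = 2 ^ J := by omega
      by_cases hH : 2 ^ J = 2 ^ m
      · omega
      · have := (G1 (m := m) (i := i) (j := 2 * 2 ^ m - a) (by omega)).1 (by
          rw [h2, show 2 * 2 ^ m - 1 - (2 * 2 ^ m - a) = r by omega]; exact hc)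
        exact c_false (k := J) (by omega) (by omega) (by omega) this
    · omega

theorem step1 {m h r d a b a' b' : ℕ} (hc : IsCell (m+1) r d) (hI : InCorners r d a b)
    (hI' : InCorners r d a' b') (hT : TT m h a b) (hh : h < 2 ^ m) : TT m (h+1) a' b' := by
  have hd := hc.2.1
  rcases hT with hT | hT
  · exact crt_in hd (cell_r1 hc hI hT hh) hI'
  · obtain ⟨h1, h2⟩ := corners_refl hd hI
    obtain ⟨h3, h4⟩ := corners_refl hd hI'
    have := (crt_in (by omega) (cell_r1 (cell_refl hc) h2 hT.2 hh) h4).refl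
    rwa [Nat.sub_sub_self h3] at this

theorem step2 {m J r d a b a' b' : ℕ} (hJ : J ≤ m) (hc : IsCell (m+1) r d) (hI : InCorners r d a b)
    (hI' : InCorners r d a' b') (hT : TT m (2^J) a b)
    (n1 : ¬ (a = 2 * 2 ^ m ∧ b = 2 ^ m + 2 ^ J)) (n2 : ¬ (a = 2 * 2 ^ m - 2 ^ J ∧ b = 2 ^ m))
    (n3 : ¬ (a = 2 * 2 ^ m ∧ a - b = 2 ^ m + 2 ^ J))
    (n4 : ¬ (a = 2 * 2 ^ m - 2 ^ J ∧ a - b = 2 ^ m)) : TT m (2^J) a' b' := by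
  have hd := hc.2.1
  rcases hT with hT | hT
  · exact crt_in hd (cell_r2 hJ hc hI hT n1 n2) hI'
  · obtain ⟨h1, h2⟩ := corners_refl hd hI
    obtain ⟨h3, h4⟩ := corners_refl hd hI'
    have := (crt_in (by omega) (cell_r2 hJ (cell_refl hc) h2 hT.2 n3 n4) h4).refl
    rwa [Nat.sub_sub_self h3] at this

theorem walk_in {m : ℕ} {x y : SGV (m+1)} (p : (SGgraph (m+1)).Walk x y) :
    ∀ h, TT m h (pv x).1 (pv x).2 → h + p.length ≤ 2 ^ m →
      TT m (h + p.length) (pv y).1 (pv y).2 := by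
  induction p with
  | nil => intro h hT _; simpa using hT
  | cons ha p ih =>
    intro h hT hl
    rw [SimpleGraph.Walk.length_cons] at *
    obtain ⟨_, r, d, hc, h1, h2⟩ := adj_iff.1 ha
    have := ih (h+1) (step1 hc h1 h2 hT (by omega)) (by omega)
    rwa [show h + 1 + p.length = h + (p.length + 1) by omega] at this

theorem down_r {m h a b : ℕ} (hv : IsVtx (m+1) (a, b)) (hh : h + 1 ≤ 2 ^ m)
    (hR : inR m (h+1) a b) : inR m h a b ∨ ∃ r d a' b', IsCell (m+1) r d ∧ InCorners r d a b ∧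
      InCorners r d a' b' ∧ inR m h a' b' := by
  by_cases hl : b + 2 ^ m ≤ a + h
  · left; unfold inR at *; omega
  right
  unfold inR at hR
  obtain ⟨i, rfl⟩ := Nat.exists_eq_add_of_le hR.1
  obtain ⟨j, hj⟩ : ∃ j, j = 2 * 2 ^ m - a := ⟨_, rfl⟩
  have hij : i + j = h + 1 := by omega
  have k1 : 1 ≤ i → c (i-1) j → ∃ r d a' b', IsCell (m+1) r d ∧ InCorners r d a (2^m+i) ∧
      InCorners r d a' b' ∧ inR m h a' b' := by
    intro hi hc
    refine ⟨_, _, a, 2^m+(i-1), (G1 (m := m) (by omega)).2 hc, ?_, ?_, ?_⟩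
    · unfold InCorners; omega
    · unfold InCorners; omega
    · unfold inR; omega
  have k2 : 1 ≤ j → c i (j-1) → ∃ r d a' b', IsCell (m+1) r d ∧ InCorners r d a (2^m+i) ∧
      InCorners r d a' b' ∧ inR m h a' b' := by
    intro hi hc
    refine ⟨_, _, a+1, 2^m+i, (G1 (m := m) (by omega)).2 hc, ?_, ?_, ?_⟩
    · unfold InCorners; omega
    · unfold InCorners; omega
    · unfold inR; omega
  rcases Nat.eq_zero_or_pos i with hi | hi
  · exact k2 (by omega) (by rw [hi]; exact c_zero_left _)
  rcases Nat.eq_zero_or_pos j with hj0 | hj0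
  · exact k1 hi (by rw [hj0]; exact c_zero_right _)
  obtain ⟨r, d, hc, h⟩ := hv
  have hc' := isCell_iff.1 hc
  rcases h with ⟨h1, h2⟩ | ⟨h1, h2⟩ | ⟨h1, h2⟩ <;> dsimp only at h1 h2
  · apply k2 hj0
    apply (G1 (m := m) (by omega)).1
    rwa [show 2 * 2 ^ m - 1 - (j - 1) = r by omega, h2]
  · have : c i j := by
      apply (G1 (m := m) (by omega)).1
      rwa [show 2 * 2 ^ m - 1 - j = r by omega, h2]
    have hp := c_pascal (i-1) (j-1)
    rw [Nat.sub_add_cancel hi, Nat.sub_add_cancel hj0] at hp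
    by_cases hq : c (i-1) j
    · exact k1 hi hq
    · exact k2 hj0 (by tauto)
  · apply k1 hi
    apply (G1 (m := m) (by omega)).1
    rwa [show 2 * 2 ^ m - 1 - j = r by omega, show 2 ^ m + (i - 1) = d by omega]

theorem down_t {m h a b : ℕ} (hv : IsVtx (m+1) (a, b)) (hh : h + 1 ≤ 2 ^ m)
    (hT : TT m (h+1) a b) : TT m h a b ∨ ∃ r d a' b', IsCell (m+1) r d ∧ InCorners r d a b ∧
      InCorners r d a' b' ∧ TT m h a' b' := by
  rcases hT with hT | hT
  · rcases down_r hv hh hT with h | ⟨r, d, a', b', h1, h2, h3, h4⟩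
    · exact Or.inl (Or.inl h)
    · exact Or.inr ⟨r, d, a', b', h1, h2, h3, Or.inl h4⟩
  · obtain ⟨hb, hv'⟩ := vtx_refl hv
    rcases down_r hv' hh hT.2 with h | ⟨r, d, a', b', h1, h2, h3, h4⟩
    · exact Or.inl (Or.inr ⟨hb, h⟩)
    · have hd := h1.2.1
      obtain ⟨_, h5⟩ := corners_refl hd h2
      obtain ⟨_, h6⟩ := corners_refl hd h3
      rw [Nat.sub_sub_self hb] at h5
      exact Or.inr ⟨r, r - d, a', a' - b', cell_refl h1, h5, h6, TT.refl (Or.inl h4)⟩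

theorem walk_of_t {m : ℕ} (v0 : SGV (m+1)) (hv0 : pv v0 = (2 * 2 ^ m, 2 ^ m)) :
    ∀ h, h ≤ 2 ^ m → ∀ x : SGV (m+1), TT m h (pv x).1 (pv x).2 →
      ∃ p : (SGgraph (m+1)).Walk v0 x, p.length ≤ h := by
  intro h
  induction h with
  | zero =>
    intro _ x hT
    have : pv x = pv v0 := by
      rw [hv0]
      unfold TT inL inR at hT
      ext
      · show (pv x).1 = 2 * 2 ^ m
        omega
      · show (pv x).2 = 2 ^ m
        omega
    obtain rfl := pv_inj this
    exact ⟨SimpleGraph.Walk.nil, le_rfl⟩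
  | succ h ih =>
    intro hh x hT
    rcases down_t (pv_vtx x) hh hT with h1 | ⟨r, d, a', b', h1, h2, h3, h4⟩
    · obtain ⟨p, hp⟩ := ih (by omega) x h1
      exact ⟨p, by omega⟩
    · have hv : IsVtx (m+1) (a', b') := ⟨r, d, h1, h3⟩
      obtain ⟨p, hp⟩ := ih (by omega) (mkV _ _ hv) h4
      by_cases he : mkV _ _ hv = x
      · subst he; exact ⟨p, by omega⟩
      · refine ⟨p.concat (adj_iff.2 ⟨he, r, d, h1, h3, h2⟩), ?_⟩
        rw [SimpleGraph.Walk.length_concat]; omega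

theorem up_cell {m a b : ℕ} (hv : IsVtx (m+1) (a+1, b)) : ∃ r d b', IsCell (m+1) r d ∧
    InCorners r d (a+1) b ∧ InCorners r d a b' := by
  obtain ⟨r, d, hc, h⟩ := hv
  rcases h with ⟨h1, h2⟩ | ⟨h1, h2⟩ | ⟨h1, h2⟩ <;> dsimp only at h1 h2
  · subst h1 h2
    rw [isCell_iff] at hc
    rcases b with _ | b
    · exact ⟨a, 0, 0, isCell_iff.2 ⟨by omega, by omega, by simp⟩, by unfold InCorners; omega,
        by unfold InCorners; omega⟩
    · rw [Nat.choose_succ_succ] at hc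
      simp only [Nat.succ_eq_add_one] at hc
      by_cases h : a.choose b % 2 = 1
      · exact ⟨a, b, b, isCell_iff.2 ⟨by omega, by omega, h⟩, by unfold InCorners; omega,
          by unfold InCorners; omega⟩
      · have h' : a.choose (b+1) % 2 = 1 := by omega
        have : b + 1 ≤ a := by
          by_contra hlt
          rw [Nat.choose_eq_zero_of_lt (by omega)] at h'
          omega
        exact ⟨a, b+1, b+1, isCell_iff.2 ⟨by omega, by omega, h'⟩, by unfold InCorners; omega,
          by unfold InCorners; omega⟩
  · exact ⟨r, d, d, hc, by unfold InCorners; omega, by unfold InCorners; omega⟩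
  · exact ⟨r, d, d, hc, by unfold InCorners; omega, by unfold InCorners; omega⟩

theorem reach {m : ℕ} (z : SGV (m+1)) (hz : pv z = (0, 0)) : ∀ a, ∀ x : SGV (m+1), (pv x).1 = a →
    (SGgraph (m+1)).Reachable x z := by
  intro a
  induction a with
  | zero =>
    intro x hx
    have hb : (pv x).2 ≤ (pv x).1 := (vtx_refl (pv_vtx x)).1
    have : pv x = pv z := by
      rw [hz]; ext
      · exact hx
      · show (pv x).2 = 0
        omega
    rw [pv_inj this]
  | succ a ih =>
    intro x hx
    have hv : IsVtx (m+1) (a+1, (pv x).2) := by rw [← hx]; exact pv_vtx x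
    obtain ⟨r, d, b', h1, h2, h3⟩ := up_cell hv
    have hv' : IsVtx (m+1) (a, b') := ⟨r, d, h1, h3⟩
    refine SimpleGraph.Reachable.trans (SimpleGraph.Adj.reachable ?_) (ih (mkV _ _ hv') rfl)
    refine adj_iff.2 ⟨?_, r, d, h1, ?_, h3⟩
    · intro he
      rw [he, pv_mk] at hx
      simp at hx
    · rw [hx]; exact h2

theorem reachable {m : ℕ} (x y : SGV (m+1)) : (SGgraph (m+1)).Reachable x y := by
  have hv : IsVtx (m+1) (0, 0) := ⟨0, 0, isCell_iff.2 ⟨by positivity, le_rfl, by simp⟩,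
    by unfold InCorners; simp⟩
  exact (reach (mkV _ _ hv) rfl _ x rfl).trans (reach (mkV _ _ hv) rfl _ y rfl).symm

theorem in_of_dist {m H : ℕ} (v0 : SGV (m+1)) (hv0 : pv v0 = (2 * 2 ^ m, 2 ^ m)) (hH : H ≤ 2 ^ m)
    (x : SGV (m+1)) (hd : (SGgraph (m+1)).dist v0 x ≤ H) : TT m H (pv x).1 (pv x).2 := by
  obtain ⟨p, hp⟩ := (reachable v0 x).exists_walk_length_eq_dist
  have := walk_in p 0 (by rw [hv0]; left; unfold inR; dsimp only; omega) (by omega)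
  unfold TT inL inR at *
  omega

theorem dist_of_in {m H : ℕ} (v0 : SGV (m+1)) (hv0 : pv v0 = (2 * 2 ^ m, 2 ^ m)) (hH : H ≤ 2 ^ m)
    (x : SGV (m+1)) (hT : TT m H (pv x).1 (pv x).2) : (SGgraph (m+1)).dist v0 x ≤ H := by
  obtain ⟨p, hp⟩ := walk_of_t v0 hv0 H hH x hT
  exact (SimpleGraph.dist_le p).trans hp

end SGL

namespace SGL

theorem GN_mono' {n : ℕ} {f g : ℕ → ℕ → ℕ} (h : ∀ a b, IsVtx n (a, b) → f a b ≤ g a b) (a b : ℕ) :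
    GN n f a b ≤ GN n g a b := by
  have key : ∀ r d x y, IsCell n r d → InCorners r d x y → f x y ≤ g x y :=
    fun r d x y hc hI => h x y ⟨r, d, hc, hI⟩
  unfold GN
  apply Nat.add_le_add
  apply Nat.add_le_add
  · split_ifs with h1
    · exact Nat.add_le_add (key _ _ _ _ h1 (by unfold InCorners; omega))
        (key _ _ _ _ h1 (by unfold InCorners; omega))
    · exact le_rfl
  · split_ifs with h1
    · exact Nat.add_le_add (key _ _ _ _ h1.2 (by unfold InCorners; omega))
        (key _ _ _ _ h1.2 (by unfold InCorners; omega))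
    · exact le_rfl
  · split_ifs with h1
    · exact Nat.add_le_add (key _ _ _ _ h1.2 (by unfold InCorners; omega))
        (key _ _ _ _ h1.2 (by unfold InCorners; omega))
    · exact le_rfl

theorem GN_ex {n a b : ℕ} {f : ℕ → ℕ → ℕ} (h : 0 < GN n f a b) : ∃ r d a' b', IsCell n r d ∧
    InCorners r d a b ∧ InCorners r d a' b' ∧ 0 < f a' b' := by
  by_contra hcon
  push Not at hcon
  have key : ∀ r d x y, IsCell n r d → InCorners r d a b → InCorners r d x y → f x y = 0 :=
    fun r d x y h1 h2 h3 => by have := hcon r d x y h1 h2 h3; omega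
  have e1 : ∀ P Q : ℕ, P = 0 → Q = 0 → P + Q = 0 := by omega
  unfold GN at h
  refine absurd h ?_
  rw [Nat.not_lt, Nat.le_zero]
  apply e1
  apply e1
  · split_ifs with h1
    · apply e1 <;> apply key _ _ _ _ h1 <;> unfold InCorners <;> omega
    · rfl
  · split_ifs with h1
    · apply e1 <;> apply key _ _ _ _ h1.2 <;> unfold InCorners <;> omega
    · rfl
  · split_ifs with h1
    · apply e1 <;> apply key _ _ _ _ h1.2 <;> unfold InCorners <;> omega
    · rfl

section corners
variable {m H : ℕ} (f : ℕ → ℕ → ℕ)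

theorem q_cell (h1 : 1 ≤ H) (hH : H ≤ 2 ^ m) : IsCell (m+1) (2 * 2 ^ m - 1) (2 ^ m + H - 1) := by
  have := (G1 (m := m) (i := H - 1) (j := 0) (by omega)).2 (c_zero_right _)
  rwa [Nat.sub_zero, show 2 ^ m + (H - 1) = 2 ^ m + H - 1 by omega] at this

theorem q_cell' (hH : H < 2 ^ m) : IsCell (m+1) (2 * 2 ^ m - 1) (2 ^ m + H) := by
  have := (G1 (m := m) (i := H) (j := 0) (by omega)).2 (c_zero_right _)
  rwa [Nat.sub_zero] at this

theorem r_cell (h1 : 1 ≤ H) (hH : H ≤ 2 ^ m) : IsCell (m+1) (2 * 2 ^ m - H) (2 ^ m) := by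
  have := (G1 (m := m) (i := 0) (j := H - 1) (by omega)).2 (c_zero_left _)
  rwa [Nat.add_zero, show 2 * 2 ^ m - 1 - (H - 1) = 2 * 2 ^ m - H by omega] at this

theorem r_cell' (hH : H < 2 ^ m) : IsCell (m+1) (2 * 2 ^ m - H - 1) (2 ^ m) := by
  have := (G1 (m := m) (i := 0) (j := H) (by omega)).2 (c_zero_left _)
  rwa [Nat.add_zero, show 2 * 2 ^ m - 1 - H = 2 * 2 ^ m - H - 1 by omega] at this

theorem q_ge (h1 : 1 ≤ H) (hH : H ≤ 2 ^ m) :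
    f (2 * 2 ^ m - 1) (2 ^ m + H - 1) + f (2 * 2 ^ m) (2 ^ m + H - 1)
      ≤ GN (m+1) f (2 * 2 ^ m) (2 ^ m + H) := by
  unfold GN
  rw [if_pos (show (1 ≤ 2 * 2 ^ m ∧ 1 ≤ 2 ^ m + H) ∧ _ from ⟨by omega, q_cell h1 hH⟩)]
  omega

theorem q_le (h1 : 1 ≤ H) (hH : H ≤ 2 ^ m) : GN (m+1) f (2 * 2 ^ m) (2 ^ m + H) ≤
    f (2 * 2 ^ m - 1) (2 ^ m + H - 1) + f (2 * 2 ^ m) (2 ^ m + H - 1)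
      + (f (2 * 2 ^ m - 1) (2 ^ m + H) + f (2 * 2 ^ m) (2 ^ m + H + 1)) := by
  unfold GN
  rw [if_neg (by rw [isCell_iff]; omega)]
  split_ifs <;> omega

theorem q_deg (h1 : 1 ≤ H) (hH : H < 2 ^ m) :
    GN (m+1) (fun _ _ => 1) (2 * 2 ^ m) (2 ^ m + H) = 4 := by
  unfold GN
  rw [if_pos (show (1 ≤ 2 * 2 ^ m ∧ 1 ≤ 2 ^ m + H) ∧ _ from ⟨by omega, q_cell h1 hH.le⟩),
    if_pos (show 1 ≤ 2 * 2 ^ m ∧ _ from ⟨by omega, q_cell' hH⟩),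
    if_neg (by rw [isCell_iff]; omega)]
  rfl

theorem r_ge (h1 : 1 ≤ H) (hH : H ≤ 2 ^ m) :
    f (2 * 2 ^ m - H + 1) (2 ^ m) + f (2 * 2 ^ m - H + 1) (2 ^ m + 1)
      ≤ GN (m+1) f (2 * 2 ^ m - H) (2 ^ m) := by
  unfold GN
  rw [if_pos (r_cell h1 hH)]
  omega

theorem r_le : GN (m+1) f (2 * 2 ^ m - H) (2 ^ m) ≤
    f (2 * 2 ^ m - H + 1) (2 ^ m) + f (2 * 2 ^ m - H + 1) (2 ^ m + 1)
      + (f (2 * 2 ^ m - H - 1) (2 ^ m) + f (2 * 2 ^ m - H) (2 ^ m + 1))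
      + (f (2 * 2 ^ m - H - 1) (2 ^ m - 1) + f (2 * 2 ^ m - H) (2 ^ m - 1)) := by
  unfold GN
  split_ifs <;> omega

theorem r_deg (h1 : 1 ≤ H) (hH : H < 2 ^ m) :
    GN (m+1) (fun _ _ => 1) (2 * 2 ^ m - H) (2 ^ m) = 4 := by
  have := GN_le_four m (2 * 2 ^ m - H) (2 ^ m)
  unfold GN at *
  rw [if_pos (r_cell h1 hH.le), if_pos (show 1 ≤ 2 * 2 ^ m - H ∧ _ from ⟨by omega, r_cell' hH⟩)] at *
  beta_reduce at *
  omega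

end corners

noncomputable def WW (m J : ℕ) (w : ℕ → ℕ → ℕ) (a b : ℕ) : ℕ :=
  if inR m (2^J) a b then w (b - 2 ^ m) (2 * 2 ^ m - a)
  else if inL m (2^J) a b then w (a - b - 2 ^ m) (2 * 2 ^ m - a) else 0

section W
variable {m J K : ℕ} {w : ℕ → ℕ → ℕ}

theorem WW_R {a b : ℕ} (h : inR m (2^J) a b) : WW m J w a b = w (b - 2 ^ m) (2 * 2 ^ m - a) := by
  unfold WW; rw [if_pos h]

theorem WW_L {a b : ℕ} (h : inL m (2^J) a b) :
    WW m J w a b = w (a - b - 2 ^ m) (2 * 2 ^ m - a) := by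
  unfold WW
  split_ifs with h1
  · congr 1; unfold inL inR at *; omega
  · rfl

theorem WW_out {a b : ℕ} (h : ¬ TT m (2^J) a b) : WW m J w a b = 0 := by
  unfold TT at h; push Not at h
  unfold WW; rw [if_neg h.1, if_neg h.2]

theorem WW_refl {a b : ℕ} (h : b ≤ a) : WW m J w a (a - b) = WW m J w a b := by
  by_cases h1 : inR m (2^J) a b
  · rw [WW_R h1, WW_L (show inL m (2^J) a (a-b) from ⟨by omega, by rwa [Nat.sub_sub_self h]⟩),
      Nat.sub_sub_self h]
  by_cases h2 : inL m (2^J) a b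
  · rw [WW_L h2, WW_R h2.2]
  have h3 : ¬ TT m (2^J) a b := by unfold TT; tauto
  rw [WW_out h3, WW_out]
  intro h4
  apply h3
  have := h4.refl
  rwa [Nat.sub_sub_self h] at this

theorem WW_q (hw : Lst J K w) {a b : ℕ}
    (h : (a = 2 * 2 ^ m ∧ b = 2 ^ m + 2 ^ J) ∨ (a = 2 * 2 ^ m - 2 ^ J ∧ b = 2 ^ m)) :
    WW m J w a b = 0 ∧ (b ≤ a → WW m J w a (a - b) = 0) := by
  have : WW m J w a b = 0 := by
    by_cases hT : TT m (2^J) a b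
    · have hp : 0 < 2 ^ J := by positivity
      have hpm : 0 < 2 ^ m := by positivity
      have hR : inR m (2^J) a b := by unfold TT inL inR at *; omega
      rw [WW_R hR]
      rcases h with ⟨rfl, rfl⟩ | ⟨rfl, rfl⟩
      · rw [show 2 ^ m + 2 ^ J - 2 ^ m = 2 ^ J by omega, Nat.sub_self]; exact hw.wq
      · unfold inR at hR
        rw [show 2 * 2 ^ m - (2 * 2 ^ m - 2 ^ J) = 2 ^ J by omega, Nat.sub_self]; exact hw.wr
    · exact WW_out hT
  exact ⟨this, fun hb => by rw [WW_refl hb, this]⟩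

theorem WW_phi (i j : ℕ) : WW m J w (2 * 2 ^ m - j) (2 ^ m + i) ≤ w i j := by
  by_cases hT : TT m (2^J) (2 * 2 ^ m - j) (2 ^ m + i)
  · have hp : 0 < 2 ^ m := by positivity
    have hR : inR m (2^J) (2 * 2 ^ m - j) (2 ^ m + i) := by unfold TT inL inR at *; omega
    rw [WW_R hR]
    unfold inR at hR
    rw [show 2 ^ m + i - 2 ^ m = i by omega, show 2 * 2 ^ m - (2 * 2 ^ m - j) = j by omega]
  · rw [WW_out hT]; omega

theorem WW_le {U : ℕ → ℕ → ℕ} (h1 : ∀ i j, w i j ≤ U (2 * 2 ^ m - j) (2 ^ m + i))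
    (h2 : ∀ i j, w i j ≤ U (2 * 2 ^ m - j) (2 * 2 ^ m - j - (2 ^ m + i))) (a b : ℕ) :
    WW m J w a b ≤ U a b := by
  unfold WW
  split_ifs with h3 h4
  · refine (h1 _ _).trans (le_of_eq ?_)
    unfold inR at h3
    congr 1 <;> omega
  · refine (h2 _ _).trans (le_of_eq ?_)
    unfold inL inR at h4
    congr 1 <;> omega
  · omega

theorem out_zero (hJ : J ≤ m) (hw : Lst J K w) {a b : ℕ} (hT : ¬ TT m (2^J) a b) :
    GN (m+1) (WW m J w) a b = 0 := by
  by_contra hne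
  obtain ⟨r, d, a', b', hc, h1, h2, h3⟩ := GN_ex (Nat.pos_of_ne_zero hne)
  apply hT
  have hb : b' ≤ a' := (corners_refl hc.2.1 h2).1
  refine step2 hJ hc h2 h1 ?_ ?_ ?_ ?_ ?_
  · by_contra h; rw [WW_out h] at h3; omega
  · intro h; rw [(WW_q hw (Or.inl h)).1] at h3; omega
  · intro h; rw [(WW_q hw (Or.inr h)).1] at h3; omega
  · intro h; rw [← WW_refl hb, (WW_q hw (Or.inl h)).1] at h3; omega
  · intro h; rw [← WW_refl hb, (WW_q hw (Or.inr h)).1] at h3; omega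

theorem superR (hJ : J ≤ m) (hw : Lst J K w)
    (hs : w (2^J - 1) 0 + w (2^J - 1) 1 ≤ 3)
    (hs' : J < m ∨ w (2^J - 1) 0 + w (2^J - 1) 1 = 0) {a b : ℕ} (hv : IsVtx (m+1) (a, b))
    (hR : inR m (2^J) a b) (h0 : ¬ (a = 2 * 2 ^ m ∧ b = 2 ^ m)) :
    GN (m+1) (WW m J w) a b < GN (m+1) (fun _ _ => 1) a b * (WW m J w a b + 1) := by
  have hp : 2 ^ J ≤ 2 ^ m := Nat.pow_le_pow_right (by norm_num) hJ
  have pos : 0 < 2 ^ J := by positivity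
  have out : ∀ x y, ¬ TT m (2^J) x y → WW m J w x y = 0 := fun x y h => WW_out h
  by_cases c1 : a = 2 * 2 ^ m ∧ b = 2 ^ m + 2 ^ J
  · obtain ⟨rfl, rfl⟩ := c1
    rw [(WW_q hw (Or.inl ⟨rfl, rfl⟩)).1]
    have hle := q_le (WW m J w) pos hp
    have p1 := WW_phi (m := m) (J := J) (w := w) (2^J - 1) 0
    have p2 := WW_phi (m := m) (J := J) (w := w) (2^J - 1) 1
    rw [Nat.sub_zero] at p1
    rw [show 2 ^ m + (2 ^ J - 1) = 2 ^ m + 2 ^ J - 1 by omega] at p1 p2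
    rw [out (2 * 2 ^ m - 1) (2 ^ m + 2 ^ J) (by unfold TT inL inR; omega),
      out (2 * 2 ^ m) (2 ^ m + 2 ^ J + 1) (by unfold TT inL inR; omega)] at hle
    rcases hs' with hs' | hs'
    · rw [q_deg pos (Nat.pow_lt_pow_right (by norm_num) hs')]; omega
    · have := GN_pos hv; omega
  by_cases c2 : a = 2 * 2 ^ m - 2 ^ J ∧ b = 2 ^ m
  · obtain ⟨rfl, rfl⟩ := c2
    rw [(WW_q hw (Or.inr ⟨rfl, rfl⟩)).1]
    have hle := r_le (m := m) (H := 2 ^ J) (WW m J w)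
    have p1 := WW_phi (m := m) (J := J) (w := w) 0 (2^J - 1)
    have p2 := WW_phi (m := m) (J := J) (w := w) 1 (2^J - 1)
    rw [hw.symm 0] at p1
    rw [hw.symm 1] at p2
    rw [Nat.add_zero] at p1
    rw [show 2 * 2 ^ m - (2 ^ J - 1) = 2 * 2 ^ m - 2 ^ J + 1 by omega] at p1 p2
    have z : WW m J w (2 * 2 ^ m - 2 ^ J) (2 ^ m - 1) = 0 := by
      by_cases hT : TT m (2^J) (2 * 2 ^ m - 2 ^ J) (2 ^ m - 1)
      · rw [← WW_refl (by unfold TT inL inR at hT; omega)]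
        exact (WW_q hw (Or.inr ⟨rfl, by unfold TT inL inR at hT; omega⟩)).1
      · exact out _ _ hT
    rw [z, out (2 * 2 ^ m - 2 ^ J - 1) (2 ^ m) (by unfold TT inL inR; omega),
      out (2 * 2 ^ m - 2 ^ J) (2 ^ m + 1) (by unfold TT inL inR; omega),
      out (2 * 2 ^ m - 2 ^ J - 1) (2 ^ m - 1) (by unfold TT inL inR; omega)] at hle
    rcases hs' with hs' | hs'
    · rw [r_deg pos (Nat.pow_lt_pow_right (by norm_num) hs')]; omega
    · have := GN_pos hv; omega
  rw [WW_R hR]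
  obtain ⟨i, hi⟩ : ∃ i, i = b - 2 ^ m := ⟨_, rfl⟩
  obtain ⟨j, hj⟩ : ∃ j, j = 2 * 2 ^ m - a := ⟨_, rfl⟩
  unfold inR at hR
  obtain rfl : a = 2 * 2 ^ m - j := by omega
  obtain rfl : b = 2 ^ m + i := by omega
  rw [← hi, ← hj]
  have hI : Inn J i j := by unfold Inn; omega
  have hV := (inn_vtx hJ hI).1 hv
  rw [GN_nbs hJ hI, GN_nbs hJ hI, nbs_one (by unfold Inn at hI; tauto) hV]
  have := (nbs_mono (w := fun i j => WW m J w (2 * 2 ^ m - j) (2 ^ m + i)) (w' := w)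
    (fun i j => WW_phi i j) i j).trans (hw.ss i j hI)
  omega

end W

theorem small_case {m J N : ℕ} {U E w : ℕ → ℕ → ℕ} (hG : Good (m+1) N U E) (hJ : J ≤ m)
    (hw : Lst J (U (2 * 2 ^ m) (2 ^ m)) w)
    (h1 : ∀ i j, w i j ≤ U (2 * 2 ^ m - j) (2 ^ m + i))
    (h2 : ∀ i j, w i j ≤ U (2 * 2 ^ m - j) (2 * 2 ^ m - j - (2 ^ m + i)))
    (hs : w (2^J - 1) 0 + w (2^J - 1) 1 ≤ 3)
    (hs' : J < m ∨ w (2^J - 1) 0 + w (2^J - 1) 1 = 0)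
    (lap : ∀ W : ℕ → ℕ → ℕ, (∀ a b, IsVtx (m+1) (a,b) →
      (if a = 2^(m+1) ∧ b = 2^(m+1-1) then N else 0) + GN (m+1) W a b
        < GN (m+1) (fun _ _ => 1) a b * (W a b + 1)) →
      ∀ a b, IsVtx (m+1) (a,b) → U a b ≤ W a b) {a b : ℕ} (hv : IsVtx (m+1) (a, b))
    (hT : ¬ TT m (2^J) a b) : E a b = 0 := by
  have e2 : 2 ^ (m+1) = 2 * 2 ^ m := by rw [pow_succ, mul_comm]
  have pos : 0 < 2 ^ J := by positivity
  have hle := lap (WW m J w) ?_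
  · have h3 := GN_mono' hle a b
    rw [out_zero hJ hw hT] at h3
    have h4 := hG.eq a b hv
    rw [if_neg] at h4
    · omega
    · rw [e2, Nat.add_sub_cancel]
      rintro ⟨rfl, rfl⟩
      apply hT; left; unfold inR; omega
  intro x y hxy
  rw [e2, Nat.add_sub_cancel]
  by_cases h0 : x = 2 * 2 ^ m ∧ y = 2 ^ m
  · rw [if_pos h0]
    have h3 := hG.eq x y hxy
    have h4 := hG.st x y hxy
    rw [e2, Nat.add_sub_cancel, if_pos h0] at h3
    have h5 := GN_mono (n := m+1) (WW_le (J := J) h1 h2) x y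
    have h6 : WW m J w x y = U x y := by
      obtain ⟨rfl, rfl⟩ := h0
      rw [WW_R (by unfold inR; omega), Nat.sub_self, Nat.sub_self, hw.w0]
    rw [h6, Nat.mul_add]
    omega
  · rw [if_neg h0, Nat.zero_add]
    by_cases hT' : TT m (2^J) x y
    · rcases hT' with hR | hL
      · exact superR hJ hw hs hs' hxy hR h0
      · obtain ⟨hb, hv'⟩ := vtx_refl hxy
        have := superR hJ hw hs hs' hv' hL.2 (by omega)
        rw [WW_refl hb, ← GN_refl hb, ← GN_refl hb] at this
        refine lt_of_le_of_lt (GN_mono' (fun a b hab => ?_) x y) this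
        exact (WW_refl (vtx_refl hab).1).ge
    · rw [out_zero hJ hw hT', WW_out hT']
      have := GN_pos hxy
      omega

theorem big_case {m J N : ℕ} {U E w : ℕ → ℕ → ℕ} (hG : Good (m+1) N U E) (hJ : J ≤ m)
    (hw : Lst J (U (2 * 2 ^ m) (2 ^ m)) w)
    (h1 : ∀ i j, w i j ≤ U (2 * 2 ^ m - j) (2 ^ m + i))
    (hs : 4 ≤ w (2^J - 1) 0 + w (2^J - 1) 1) {a b : ℕ} (hv : IsVtx (m+1) (a, b))
    (hR : inR m (2^J) a b) : 1 ≤ U a b := by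
  have hp : 2 ^ J ≤ 2 ^ m := Nat.pow_le_pow_right (by norm_num) hJ
  have pos : 0 < 2 ^ J := by positivity
  have e2 : 2 ^ (m+1) = 2 * 2 ^ m := by rw [pow_succ, mul_comm]
  by_contra hU
  have hU0 : U a b = 0 := by omega
  by_cases c0 : a = 2 * 2 ^ m ∧ b = 2 ^ m
  · obtain ⟨rfl, rfl⟩ := c0
    have := hw.le (fun _ _ => 0) hU0.le (by intro i j _; unfold nbs; simp)
    have h3 := this (2^J-1) 0
    have h4 := this (2^J-1) 1
    beta_reduce at h3 h4
    omega
  have h3 := hG.eq a b hv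
  have h4 := hG.st a b hv
  have h5 := GN_le_four m a b
  rw [e2, Nat.add_sub_cancel, if_neg c0, hU0] at h3
  by_cases c1 : a = 2 * 2 ^ m ∧ b = 2 ^ m + 2 ^ J
  · obtain ⟨rfl, rfl⟩ := c1
    have hge := q_ge U pos hp
    have p1 := h1 (2^J - 1) 0
    have p2 := h1 (2^J - 1) 1
    rw [Nat.sub_zero] at p1
    rw [show 2 ^ m + (2 ^ J - 1) = 2 ^ m + 2 ^ J - 1 by omega] at p1 p2
    omega
  by_cases c2 : a = 2 * 2 ^ m - 2 ^ J ∧ b = 2 ^ m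
  · obtain ⟨rfl, rfl⟩ := c2
    have hge := r_ge U pos hp
    have p1 := h1 0 (2^J - 1)
    have p2 := h1 1 (2^J - 1)
    rw [hw.symm 0, Nat.add_zero] at p1
    rw [hw.symm 1] at p2
    rw [show 2 * 2 ^ m - (2 ^ J - 1) = 2 * 2 ^ m - 2 ^ J + 1 by omega] at p1 p2
    omega
  obtain ⟨i, hi⟩ : ∃ i, i = b - 2 ^ m := ⟨_, rfl⟩
  obtain ⟨j, hj⟩ : ∃ j, j = 2 * 2 ^ m - a := ⟨_, rfl⟩
  unfold inR at hR
  obtain rfl : a = 2 * 2 ^ m - j := by omega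
  obtain rfl : b = 2 ^ m + i := by omega
  have hI : Inn J i j := by unfold Inn; omega
  have := main_local J _ w hw (by omega) i j hI ((inn_vtx hJ hI).1 hv)
  have := h1 i j
  omega

theorem final (m N j : ℕ) (v0 : SGV (m+1)) (hv0' : pv v0 = (2 ^ (m+1), 2 ^ (m+1-1)))
    (l : List (SGV (m+1))) (η' : SGV (m+1) → ℕ)
    (hl : Topples (SGgraph (m+1)) ∅ (fun v => if v = v0 then N else 0) l η')
    (hstable : Stable (SGgraph (m+1)) ∅ η')
    (hboundary : ∀ b ∈ SGBoundary (m+1), b ∉ l ∧ η' b = 0)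
    (v : SGV (m+1)) (hd : 2 ^ j < (SGgraph (m+1)).dist v0 v) (hv1 : 1 ≤ η' v) :
    ∀ u : SGV (m+1), (SGgraph (m+1)).dist v0 u ≤ 2 ^ j → u ∈ l := by
  have e2 : 2 ^ (m+1) = 2 * 2 ^ m := by rw [pow_succ, mul_comm]
  have hv0 : pv v0 = (2 * 2 ^ m, 2 ^ m) := by rw [hv0', e2, Nat.add_sub_cancel]
  obtain ⟨U, E, hG, hU, hE, lap⟩ := to_good (m+1) N v0 hv0' l η' hl hstable
  have main : ∀ J, J ≤ m → 2 ^ J ≤ 2 ^ j → ∃ w, Lst J (U (2 * 2 ^ m) (2 ^ m)) w ∧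
      (∀ i j, w i j ≤ U (2 * 2 ^ m - j) (2 ^ m + i)) ∧
      (∀ i j, w i j ≤ U (2 * 2 ^ m - j) (2 * 2 ^ m - j - (2 ^ m + i))) ∧
      ((J < m ∨ w (2^J - 1) 0 + w (2^J - 1) 1 = 0) → 4 ≤ w (2^J - 1) 0 + w (2^J - 1) 1) := by
    intro J hJ hJj
    have hp : 2 ^ J ≤ 2 ^ m := Nat.pow_le_pow_right (by norm_num) hJ
    have ss1 := hG.ss hJ
    have ss2 := hG.refl.ss hJ
    obtain ⟨w, hw⟩ := exists_lst J (U (2 * 2 ^ m) (2 ^ m)) _ (by simp) ss1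
    have h1 := hw.le _ (by simp) ss1
    have h2 := hw.le _ (by simp [show 2 * 2 ^ m - 2 ^ m = 2 ^ m by omega]) ss2
    refine ⟨w, hw, h1, h2, ?_⟩
    intro hs'
    by_contra hs
    have hT : ¬ TT m (2^J) (pv v).1 (pv v).2 := by
      intro hT
      have := dist_of_in v0 hv0 hp v hT
      omega
    have : E (pv v).1 (pv v).2 = 0 := small_case hG hJ hw h1 h2 (by omega) hs' lap (pv_vtx v) hT
    rw [hE v] at this
    omega
  by_cases hj : j < m
  · obtain ⟨w, hw, h1, h2, h3⟩ := main j hj.le le_rfl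
    have hs := h3 (Or.inl hj)
    intro u hu
    have hT := in_of_dist v0 hv0 (Nat.pow_le_pow_right (by norm_num) hj.le) u hu
    by_contra hul
    have hU0 := (hU u).2 hul
    rcases hT with hT | hT
    · have : 1 ≤ U (pv u).1 (pv u).2 := big_case hG hj.le hw h1 hs (pv_vtx u) hT
      omega
    · obtain ⟨hb, hv'⟩ := vtx_refl (pv_vtx u)
      have := big_case hG.refl hj.le (w := w)
        (by beta_reduce; rwa [show 2 * 2 ^ m - 2 ^ m = 2 ^ m by omega]) h2 hs hv' hT.2
      beta_reduce at this
      rw [Nat.sub_sub_self hb] at this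
      change 1 ≤ U (pv u).1 (pv u).2 at this
      omega
  · exfalso
    obtain ⟨w, hw, h1, h2, h3⟩ := main m le_rfl (Nat.pow_le_pow_right (by norm_num) (by omega))
    have pos : 0 < 2 ^ m := by positivity
    have hq : IsVtx (m+1) (2 * 2 ^ m, 2 ^ m + 2 ^ m) :=
      ⟨_, _, q_cell pos le_rfl, by unfold InCorners; dsimp only; omega⟩
    have hB := hboundary (mkV _ _ hq) (by
      right; right
      show (2 * 2 ^ m, 2 ^ m + 2 ^ m) = (2 ^ (m+1), 2 ^ (m+1))
      rw [e2, two_mul])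
    have hU0 := (hU (mkV _ _ hq)).2 hB.1
    have hE0 := hE (mkV _ _ hq)
    rw [hB.2] at hE0
    rw [pv_mk] at hU0 hE0
    have h4 := hG.eq _ _ hq
    rw [if_neg (by rw [Nat.add_sub_cancel]; omega), hU0, hE0] at h4
    have hge := q_ge U pos le_rfl
    have p1 := h1 (2^m - 1) 0
    have p2 := h1 (2^m - 1) 1
    rw [Nat.sub_zero] at p1
    rw [show 2 ^ m + (2 ^ m - 1) = 2 ^ m + 2 ^ m - 1 by omega] at p1 p2
    have : w (2^m - 1) 0 + w (2^m - 1) 1 = 0 := by omega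
    have := h3 (Or.inr this)
    omega

end SGL

/-- In the sandpile process on a sufficiently large graph approximation
`SG_n` of the Sierpinski gasket obtained by placing `N` grains at the midpoint `v0` of the
bottom boundary and stabilizing (no grain ever reaching the boundary): if in the
stabilized configuration some vertex `v` with `d(v, v0) > 2^j` carries at least one grain,
then every vertex within graph distance `2^j` of `v0` has toppled at least once. -/
theorem sg_everything_inside_topples
    (n : ℕ) (hn : 1 ≤ n) (N : ℕ) (hN : 1 ≤ N) (j : ℕ)
    (v0 : SGV n) (hv0 : v0.val = (2 ^ n, 2 ^ (n - 1)))
    (l : List (SGV n)) (η' : SGV n → ℕ)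
    (hl : Topples (SGgraph n) ∅ (fun v => if v = v0 then N else 0) l η')
    (hstable : Stable (SGgraph n) ∅ η')
    (hboundary : ∀ b ∈ SGBoundary n, b ∉ l ∧ η' b = 0)
    (hfar : ∃ v : SGV n, 2 ^ j < (SGgraph n).dist v0 v ∧ 1 ≤ η' v) :
    ∀ u : SGV n, (SGgraph n).dist v0 u ≤ 2 ^ j → u ∈ l := by
  obtain ⟨v, hd, hv1⟩ := hfar
  obtain ⟨m, rfl⟩ : ∃ m, n = m + 1 := ⟨n - 1, by omega⟩
  exact SGL.final m N j v0 hv0 l η' hl hstable hboundary v hd hv1
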